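/- arXiv:1708.07316 — 2 statements merged into one kernel-verified Lean document; each statement's English description precedes it below -/
import Mathlib

section
/- Let Φ be a reduced irreducible root system spanning V, with weight lattice P. An element χ ∈ P is quasi-constant if and only if there exist an integer m and an element χ₀ ∈ P such that χ = m·χ₀ and χ₀ is either minuscule or cominuscule. -/
namespace QC

open Classical

variable {V : Type*} [AddCommGroup V] [Module ℚ V]

/-- The contragredient action of a linear automorphism `w` of `V` on the dual space,
characterized by `⟨w x, coact w f⟩ = ⟨x, f⟩`, i.e. `(coact w f) x = f (w⁻¹ x)`. -/
noncomputable def coact (w : V ≃ₗ[ℚ] V) (f : Module.Dual ℚ V) : Module.Dual ℚ V :=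
  w.symm.dualMap f

/-- The Weyl group of the data `(Φ, co)`: the subgroup of linear automorphisms of `V`
generated by the reflections `s_α : x ↦ x - ⟨x, α∨⟩ α` for `α ∈ Φ`. -/
def weylGroup (Φ : Set V) (co : V → Module.Dual ℚ V) : Subgroup (V ≃ₗ[ℚ] V) :=
  Subgroup.closure { w : V ≃ₗ[ℚ] V | ∃ α ∈ Φ, ∀ x : V, w x = x - (co α x) • α }

/-- `χ ∈ V` is quasi-constant with respect to a group `G` of automorphisms
(typically the Weyl group, or `W ⋊ Γ`). -/
def IsQuasiConstantWrt (Φ : Set V) (co : V → Module.Dual ℚ V)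
    (G : Subgroup (V ≃ₗ[ℚ] V)) (χ : V) : Prop :=
  ∀ α ∈ Φ, co α χ ≠ 0 → ∀ σ, σ ∈ G → coact σ (co α) χ / co α χ ∈ ({-1, 0, 1} : Set ℚ)

/-- `χ ∈ V` is quasi-constant (with respect to the Weyl group). -/
def IsQuasiConstant (Φ : Set V) (co : V → Module.Dual ℚ V) (χ : V) : Prop :=
  IsQuasiConstantWrt Φ co (weylGroup Φ co) χ

/-- A coweight `μ ∈ V∨` is quasi-constant with respect to a group `G`. -/
def IsQuasiConstantCowtWrt (Φ : Set V) (G : Subgroup (V ≃ₗ[ℚ] V))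
    (μ : Module.Dual ℚ V) : Prop :=
  ∀ α ∈ Φ, μ α ≠ 0 → ∀ σ, σ ∈ G → μ (σ α) / μ α ∈ ({-1, 0, 1} : Set ℚ)

/-- A coweight `μ ∈ V∨` is quasi-constant (with respect to the Weyl group). -/
def IsQuasiConstantCowt (Φ : Set V) (co : V → Module.Dual ℚ V)
    (μ : Module.Dual ℚ V) : Prop :=
  IsQuasiConstantCowtWrt Φ (weylGroup Φ co) μ

/-- `χ ∈ V` is minuscule: `⟨χ, α∨⟩ ∈ {-1,0,1}` for all roots `α`. -/
def IsMinuscule (Φ : Set V) (co : V → Module.Dual ℚ V) (χ : V) : Prop :=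
  ∀ α ∈ Φ, co α χ ∈ ({-1, 0, 1} : Set ℚ)

/-- `μ ∈ V∨` is minuscule: `⟨α, μ⟩ ∈ {-1,0,1}` for all roots `α`. -/
def IsMinusculeCowt (Φ : Set V) (μ : Module.Dual ℚ V) : Prop :=
  ∀ α ∈ Φ, μ α ∈ ({-1, 0, 1} : Set ℚ)

/-- The weight lattice `P = {χ ∈ V : ⟨χ, β∨⟩ ∈ ℤ for all β ∈ Φ}`. -/
def weightLattice (Φ : Set V) (co : V → Module.Dual ℚ V) : Set V :=
  { χ | ∀ β ∈ Φ, ∃ n : ℤ, co β χ = (n : ℚ) }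

/-- The coweight lattice `P∨ = {μ ∈ V∨ : ⟨α, μ⟩ ∈ ℤ for all α ∈ Φ}`. -/
def coweightLattice (Φ : Set V) : Set (Module.Dual ℚ V) :=
  { μ | ∀ α ∈ Φ, ∃ n : ℤ, μ α = (n : ℚ) }

/-- `(Φ, co)` is a reduced root system (not necessarily spanning) in `V`, where
`co α` is the coroot `α∨` viewed as a linear functional, with the Weyl group acting
compatibly on roots and coroots. -/
structure IsRootSystem (Φ : Set V) (co : V → Module.Dual ℚ V) : Prop where
  finite : Φ.Finite
  ne_zero : ∀ α ∈ Φ, α ≠ 0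
  pair_self : ∀ α ∈ Φ, co α α = 2
  refl_mem : ∀ α ∈ Φ, ∀ β ∈ Φ, β - (co α β) • α ∈ Φ
  pair_int : ∀ α ∈ Φ, ∀ β ∈ Φ, ∃ n : ℤ, co α β = (n : ℚ)
  reduced : ∀ α ∈ Φ, ∀ c : ℚ, c • α ∈ Φ → c = 1 ∨ c = -1
  weyl_root : ∀ w, w ∈ weylGroup Φ co → ∀ α ∈ Φ, w α ∈ Φ
  weyl_coroot : ∀ w, w ∈ weylGroup Φ co → ∀ α ∈ Φ, co (w α) = coact w (co α)

/-- `Φ` is irreducible: it is nonempty and admits no nontrivial orthogonal decomposition. -/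
def IsIrreducible (Φ : Set V) (co : V → Module.Dual ℚ V) : Prop :=
  Φ.Nonempty ∧ ∀ Ψ ⊆ Φ, (∀ α ∈ Ψ, ∀ β ∈ Φ \ Ψ, co α β = 0) → Ψ = ∅ ∨ Ψ = Φ

/-- `Δ` is a base (set of simple roots) of `Φ`. -/
structure IsBase (Φ : Set V) (co : V → Module.Dual ℚ V) (Δ : Set V) : Prop where
  subset : Δ ⊆ Φ
  indep : LinearIndependent ℚ ((↑) : Δ → V)
  span_eq : Submodule.span ℚ Δ = Submodule.span ℚ Φ
  decomp : ∀ α ∈ Φ, ∃ c : V →₀ ℕ, ↑c.support ⊆ Δ ∧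
      (α = c.sum (fun v n => (n : ℚ) • v) ∨ α = - c.sum (fun v n => (n : ℚ) • v))

/-- `η` is the fundamental weight `η(α)` for the simple root `α ∈ Δ`:
`⟨η, β∨⟩ = δ_{αβ}` for `β ∈ Δ`. -/
def IsFundWeight (co : V → Module.Dual ℚ V) (Δ : Set V) (α : V) (η : V) : Prop :=
  ∀ β ∈ Δ, co β η = if β = α then 1 else 0

/-- `f` is the fundamental coweight `η(α∨)` for the simple root `α ∈ Δ`:
`⟨β, f⟩ = δ_{αβ}` for `β ∈ Δ`. -/
def IsFundCoweight (Δ : Set V) (α : V) (f : Module.Dual ℚ V) : Prop :=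
  ∀ β ∈ Δ, f β = if β = α then 1 else 0

/-- `χ` is cominuscule: `χ = η(α)` for some base `Δ` and `α ∈ Δ` such that the
fundamental coweight `η(α∨)` is minuscule. -/
def IsCominuscule (Φ : Set V) (co : V → Module.Dual ℚ V) (χ : V) : Prop :=
  χ ∈ Submodule.span ℚ Φ ∧
  ∃ Δ : Set V, IsBase Φ co Δ ∧ ∃ α ∈ Δ, IsFundWeight co Δ α χ ∧
    ∀ f : Module.Dual ℚ V, IsFundCoweight Δ α f → IsMinusculeCowt Φ f

/-- `μ` is a cominuscule coweight: `μ = η(α∨)` for some base `Δ` and `α ∈ Δ` such that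
the fundamental weight `η(α)` is minuscule. -/
def IsCominusculeCowt (Φ : Set V) (co : V → Module.Dual ℚ V)
    (μ : Module.Dual ℚ V) : Prop :=
  ∃ Δ : Set V, IsBase Φ co Δ ∧ ∃ α ∈ Δ, IsFundCoweight Δ α μ ∧
    ∀ η : V, IsFundWeight co Δ α η → IsMinuscule Φ co η

/-- `χ` is `Δ`-dominant. -/
def IsDominant (co : V → Module.Dual ℚ V) (Δ : Set V) (χ : V) : Prop :=
  ∀ α ∈ Δ, 0 ≤ co α χ

/-- `μ ∈ V∨` is `Δ`-dominant. -/
def IsDominantCowt (Δ : Set V) (μ : Module.Dual ℚ V) : Prop :=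
  ∀ α ∈ Δ, 0 ≤ μ α

/-- `χ` is orbitally `p`-close. -/
def IsOrbitallyPClose (Φ : Set V) (co : V → Module.Dual ℚ V) (p : ℕ) (χ : V) : Prop :=
  ∀ α ∈ Φ, co α χ ≠ 0 → ∀ w, w ∈ weylGroup Φ co →
    |coact w (co α) χ / co α χ| ≤ (p : ℚ) - 1

end QC

namespace QC

open Module Set

section RootSystem

variable {V : Type*} [AddCommGroup V] [Module ℚ V] {Φ : Set V} {co : V → Module.Dual ℚ V}

namespace IsRootSystem

variable (h : IsRootSystem Φ co)

include h

lemma reflection_mem {α : V} (hα : α ∈ Φ) :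
    reflection (h.pair_self α hα) ∈ weylGroup Φ co :=
  Subgroup.subset_closure ⟨α, hα, fun x ↦ reflection_apply x _⟩

lemma co_weyl_apply {w : V ≃ₗ[ℚ] V} (hw : w ∈ weylGroup Φ co) {α : V} (hα : α ∈ Φ) (x : V) :
    co (w α) (w x) = co α x := by
  simp [h.weyl_coroot w hw α hα, coact]

lemma co_reflection {α β : V} (hα : α ∈ Φ) (hβ : β ∈ Φ) (x : V) :
    co (β - co α β • α) x = co β x - co α x * co β α := by
  have := h.co_weyl_apply (h.reflection_mem hα) hβ (reflection (h.pair_self α hα) x)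
  rw [involutive_reflection (h.pair_self α hα) x, reflection_apply, reflection_apply] at this
  simpa using this

lemma co_injOn : InjOn co Φ := by
  intro α hα β hβ hαβ
  by_contra hne
  have hαα := h.pair_self α hα
  have hββ := h.pair_self β hβ
  rw [← hαβ] at hββ
  have key : ∀ n : ℕ, β + (2 * n : ℚ) • (α - β) ∈ Φ := by
    intro n
    induction n with
    | zero => simpa
    | succ n ih =>
      have h₁ := h.refl_mem β hβ _ ih
      have h₂ := h.refl_mem α hα _ h₁
      convert h₂ using 1
      simp only [← hαβ, map_add, map_sub, map_smul, smul_eq_mul, hαα, hββ]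
      push_cast
      module
  refine (infinite_of_injective_forall_mem (fun n m hnm ↦ ?_) key) h.finite
  have := sub_ne_zero.mpr hne
  simpa [this] using hnm

/-- The Mathlib root pairing attached to a root system spanning `V`. -/
noncomputable def rootPairing [FiniteDimensional ℚ V] (hspan : Submodule.span ℚ Φ = ⊤) :
    RootPairing Φ ℚ V (Dual ℚ V) :=
  have : Finite Φ := h.finite
  .mk'' (Dual.eval ℚ V) (Function.Embedding.subtype (· ∈ Φ))
    ⟨fun α ↦ co α, fun α β hαβ ↦ Subtype.ext (h.co_injOn α.2 β.2 hαβ)⟩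
    (fun α ↦ h.pair_self α α.2)
    (by
      rintro α - ⟨β, rfl⟩
      exact ⟨⟨_, h.refl_mem α α.2 β β.2⟩, rfl⟩)
    (by
      rw [show range (Function.Embedding.subtype (· ∈ Φ)) = Φ from Subtype.range_coe]
      exact hspan)

section rootPairing

variable [FiniteDimensional ℚ V] (hspan : Submodule.span ℚ Φ = ⊤)

include hspan

lemma rootPairing_pairing (α β : Φ) : (h.rootPairing hspan).pairing α β = co β α := rfl

lemma isCrystallographic_rootPairing : (h.rootPairing hspan).IsCrystallographic :=
  ⟨fun α β ↦ by
    obtain ⟨n, hn⟩ := h.pair_int β β.2 α α.2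
    exact ⟨n, by simp [rootPairing_pairing, hn]⟩⟩

lemma isRootSystem_rootPairing : (h.rootPairing hspan).IsRootSystem :=
  have : Finite Φ := h.finite
  RootPairing.isRootSystem_mk'' (hsp := by
      rw [show range (Function.Embedding.subtype (· ∈ Φ)) = Φ from Subtype.range_coe]
      exact hspan) fun α β ↦ by
    obtain ⟨n, hn⟩ := h.pair_int β β.2 α α.2
    exact ⟨n, hn.symm⟩

lemma isReduced_rootPairing : (h.rootPairing hspan).IsReduced where
  eq_or_eq_neg α β hαβ := by
    change (α : V) = β ∨ (α : V) = -β
    have hlin : ¬ LinearIndependent ℚ ![(β : V), α] := by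
      rwa [LinearIndependent.pair_symm_iff]
    rw [LinearIndependent.pair_iff' (h.ne_zero β β.2)] at hlin
    push Not at hlin
    obtain ⟨c, hc⟩ := hlin
    rcases h.reduced β β.2 c (hc ▸ α.2) with rfl | rfl
    · exact .inl (by simpa using hc.symm)
    · exact .inr (by simpa using hc.symm)

/-- The possible pairs of Cartan integers of two roots. -/
lemma co_co_mem {α β : V} (hα : α ∈ Φ) (hβ : β ∈ Φ) :
    ∃ m n : ℤ, co β α = m ∧ co α β = n ∧ (m, n) ∈
      ({(0, 0), (1, 1), (-1, -1), (1, 2), (2, 1), (-1, -2), (-2, -1), (1, 3), (3, 1), (-1, -3),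
        (-3, -1), (2, 2), (-2, -2)} : Set (ℤ × ℤ)) := by
  have : Finite Φ := h.finite
  have := h.isCrystallographic_rootPairing hspan
  have := h.isReduced_rootPairing hspan
  let P := h.rootPairing hspan
  have key (α β : Φ) : co β α = P.pairingIn ℤ α β :=
    (P.algebraMap_pairingIn ℤ α β).symm
  exact ⟨_, _, key ⟨α, hα⟩ ⟨β, hβ⟩, key ⟨β, hβ⟩ ⟨α, hα⟩,
    P.pairingIn_pairingIn_mem_set_of_isCrystal_of_isRed ⟨α, hα⟩ ⟨β, hβ⟩⟩

/-- A root system carries a Weyl-invariant bilinear form which computes the coroots. -/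
lemma exists_form :
    ∃ B : LinearMap.BilinForm ℚ V, (∀ x y, B x y = B y x) ∧
      (∀ w ∈ weylGroup Φ co, ∀ x y, B (w x) (w y) = B x y) ∧
      (∀ α ∈ Φ, 0 < B α α) ∧ ∀ α ∈ Φ, ∀ x, 2 * B x α = co α x * B α α := by
  have : Fintype Φ := h.finite.fintype
  let P := h.rootPairing hspan
  have hsymm (x y : V) : P.RootForm x y = P.RootForm y x := P.rootForm_symmetric.eq x y
  refine ⟨P.RootForm, hsymm, fun w hw ↦ ?_, fun α hα ↦ ?_, fun α hα x ↦ ?_⟩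
  · induction hw using Subgroup.closure_induction with
    | mem w hw =>
      obtain ⟨α, hα, hw⟩ := hw
      obtain rfl : w = P.reflection ⟨α, hα⟩ := LinearEquiv.ext fun x ↦ hw x
      exact P.rootForm_reflection_reflection_apply _
    | one => simp
    | mul w₁ w₂ _ _ ih₁ ih₂ => simp [ih₁, ih₂]
    | inv w _ ih =>
      intro x y
      rw [← ih, ← LinearEquiv.mul_apply, ← LinearEquiv.mul_apply]
      simp
  · refine lt_of_lt_of_eq ?_ (P.rootForm_root_self ⟨α, hα⟩).symm
    refine Finset.sum_pos' (fun i _ ↦ mul_self_nonneg _) ⟨⟨α, hα⟩, Finset.mem_univ _, ?_⟩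
    simp
  · have := LinearMap.congr_fun (P.rootForm_self_smul_coroot ⟨α, hα⟩) x
    rw [hsymm x α, mul_comm (co α x)]
    refine Eq.trans ?_ this.symm
    rw [← P.toLinearMap_apply_apply_Polarization α x, LinearMap.smul_apply, nsmul_eq_mul]
    rfl

/-- Any functional taking values in `{-1, 0, 1}` on the roots is dominant for some base, and the
simple coroots of that base generate the coroot lattice. -/
lemma exists_isBase_nonneg {f : Dual ℚ V} (hf : IsMinusculeCowt Φ f) :
    ∃ Δ, IsBase Φ co Δ ∧ (∀ α ∈ Δ, 0 ≤ f α) ∧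
      ∀ α ∈ Φ, co α ∈ Submodule.span ℤ (co '' Δ) := by
  have : Fintype Φ := h.finite.fintype
  have := h.isCrystallographic_rootPairing hspan
  have := h.isReduced_rootPairing hspan
  have := h.isRootSystem_rootPairing hspan
  let P := h.rootPairing hspan
  let _ := P.indexNeg
  obtain ⟨g, hg⟩ : ∃ g : Dual ℚ V, ∀ i, g (P.root i) ≠ 0 :=
    exists_dual_forall_apply_ne_zero P.root fun i ↦ P.ne_zero i
  obtain ⟨N, hN⟩ : ∃ N : ℚ, ∀ α ∈ Φ, |g α| < N := by
    obtain ⟨N, hN⟩ := (h.finite.image fun α ↦ |g α|).bddAbove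
    exact ⟨N + 1, fun α hα ↦ (hN (mem_image_of_mem _ hα)).trans_lt (lt_add_one N)⟩
  let g' : Dual ℚ V := g + N • f
  have hg' (i : Φ) : g' (P.root i) ≠ 0 ∧ (0 < g' (P.root i) → 0 ≤ f (P.root i)) := by
    have h₁ := abs_lt.mp (hN i i.2)
    have h₂ : g i ≠ 0 := hg i
    change g i + N * f i ≠ 0 ∧ (0 < g i + N * f i → 0 ≤ f i)
    rcases hf i i.2 with h₃ | h₃ | h₃ <;> rw [h₃]
    · refine ⟨?_, ?_⟩ <;> grind
    · simpa
    · refine ⟨?_, ?_⟩ <;> grind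
  let s := IsAddIndecomposable.baseOf P.root (g' : V →+ ℚ)
  have hli : LinearIndepOn ℚ P.root s := P.linearIndepOn_root_baseOf _ fun i ↦ (hg' i).1
  have hsp (i : Φ) := IsAddIndecomposable.mem_or_neg_mem_closure_baseOf P.root (g' : V →+ ℚ) i
    (hg' i).1 (by simp)
  let b := RootPairing.Base.mk' P s hli hsp
  have hcoroot : P.coroot '' b.support = co '' (Subtype.val '' s) := by
    rw [image_image]
    simp only [b, RootPairing.Base.mk', Finite.coe_toFinset]
    rfl
  refine ⟨Subtype.val '' s, ⟨?_, ?_, ?_, ?_⟩, ?_, ?_⟩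
  · rintro - ⟨i, -, rfl⟩
    exact i.2
  · exact hli.id_image
  · refine le_antisymm (Submodule.span_mono ?_) (Submodule.span_le.mpr fun α hα ↦ ?_)
    · rintro - ⟨i, -, rfl⟩
      exact i.2
    · have key : AddSubmonoid.closure (P.root '' s) ≤
          (Submodule.span ℚ (Subtype.val '' s)).toAddSubmonoid :=
        AddSubmonoid.closure_le.mpr Submodule.subset_span
      rcases hsp ⟨α, hα⟩ with hi | hi
      · exact key hi
      · exact neg_mem_iff.mp (key hi)
  · intro α hα
    rcases hsp ⟨α, hα⟩ with hi | hi <;>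
    · rw [← Submodule.span_nat_eq_addSubmonoidClosure, Submodule.mem_toAddSubmonoid,
        Submodule.mem_span_set] at hi
      obtain ⟨c, hc, hcα⟩ := hi
      refine ⟨c, hc, ?_⟩
      simp only [Nat.cast_smul_eq_nsmul, hcα]
      first
        | exact .inl rfl
        | exact .inr (neg_neg _).symm
  · rintro - ⟨i, hi, rfl⟩
    exact (hg' i).2 hi.1
  · intro α hα
    rw [← hcoroot]
    exact b.coroot_mem_span_int ⟨α, hα⟩

end rootPairing

lemma co_eq_zero_of_co_eq_zero [FiniteDimensional ℚ V] (hspan : Submodule.span ℚ Φ = ⊤) {α β : V}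
    (hα : α ∈ Φ) (hβ : β ∈ Φ) (hαβ : co α β = 0) : co β α = 0 := by
  obtain ⟨m, n, hm, hn, hmn⟩ := h.co_co_mem hspan hα hβ
  obtain rfl : n = 0 := by exact_mod_cast hn.symm.trans hαβ
  have : m = 0 := by simpa using hmn
  simp [hm, this]

lemma exists_weyl_co_ne_zero [FiniteDimensional ℚ V] (hspan : Submodule.span ℚ Φ = ⊤)
    (hirr : IsIrreducible Φ co) {α β : V} (hα : α ∈ Φ) (hβ : β ∈ Φ) :
    ∃ w ∈ weylGroup Φ co, co β (w α) ≠ 0 := by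
  have hΨ := hirr.2 {β ∈ Φ | ∃ w ∈ weylGroup Φ co, co β (w α) ≠ 0} (sep_subset _ _) ?_
  · have hα' : α ∈ {β ∈ Φ | ∃ w ∈ weylGroup Φ co, co β (w α) ≠ 0} :=
      ⟨hα, 1, one_mem _, by simp [h.pair_self α hα]⟩
    rcases hΨ with hΨ | hΨ
    · simp [hΨ] at hα'
    · exact (hΨ.symm ▸ hβ : β ∈ {β ∈ Φ | ∃ w ∈ weylGroup Φ co, co β (w α) ≠ 0}).2
  · rintro β ⟨hβ, w, hw, hβw⟩ γ ⟨hγ, hγ'⟩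
    have key (w) (hw : w ∈ weylGroup Φ co) : co γ (w α) = 0 := by
      by_contra hne
      exact hγ' ⟨hγ, w, hw, hne⟩
    have h₁ := key _ (mul_mem (h.reflection_mem hβ) hw)
    rw [LinearEquiv.mul_apply, reflection_apply, map_sub, key w hw, map_smul] at h₁
    exact h.co_eq_zero_of_co_eq_zero hspan hγ hβ (by simpa [hβw] using h₁)

lemma exists_weyl_co_apply_ne_zero (hirr : IsIrreducible Φ co) {χ : V}
    (hχ : ∃ β ∈ Φ, co β χ ≠ 0) {α : V} (hα : α ∈ Φ) :
    ∃ w ∈ weylGroup Φ co, co (w α) χ ≠ 0 := by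
  by_contra! hα'
  have hΨ := hirr.2 {β ∈ Φ | ∀ w ∈ weylGroup Φ co, co (w β) χ = 0} (sep_subset _ _) ?_
  · obtain ⟨β, hβ, hβχ⟩ := hχ
    rcases hΨ with hΨ | hΨ
    · exact hΨ.subset ⟨hα, hα'⟩
    · exact hβχ ((hΨ.symm.subset hβ).2 1 (one_mem _))
  · rintro α ⟨hα, hα'⟩ β ⟨hβ, hβ'⟩
    obtain ⟨w, hw, hwβ⟩ : ∃ w ∈ weylGroup Φ co, co (w β) χ ≠ 0 := by
      by_contra! hne
      exact hβ' ⟨hβ, hne⟩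
    have hwα := h.weyl_root w hw α hα
    have hwβ' := h.weyl_root w hw β hβ
    have h₁ := hα' _ (mul_mem (h.reflection_mem hwβ') hw)
    rw [LinearEquiv.mul_apply, reflection_apply, h.co_reflection hwβ' hwα, hα' w hw,
      h.co_weyl_apply hw hα] at h₁
    simpa [hwβ] using h₁

lemma exists_quasiConstant_abs (hirr : IsIrreducible Φ co) {χ : V}
    (hχ : ∃ β ∈ Φ, co β χ ≠ 0) (hqc : IsQuasiConstant Φ co χ) :
    ∃ c : V → ℚ, ∀ α ∈ Φ, 0 < c α ∧ (∃ w ∈ weylGroup Φ co, |co (w α) χ| = c α) ∧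
      (co α χ = 0 ∨ |co α χ| = c α) ∧ ∀ w ∈ weylGroup Φ co, c (w α) = c α := by
  choose! u hu hu' using fun α hα ↦ h.exists_weyl_co_apply_ne_zero hirr hχ (α := α) hα
  have key {α : V} (hα : α ∈ Φ) {w} (hw : w ∈ weylGroup Φ co) (hne : co (w α) χ ≠ 0) {w'}
      (hw' : w' ∈ weylGroup Φ co) : co (w' α) χ = 0 ∨ |co (w' α) χ| = |co (w α) χ| := by
    have h₁ := hqc (w α) (h.weyl_root w hw α hα) hne (w' * w⁻¹) (mul_mem hw' (inv_mem hw))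
    rw [← h.weyl_coroot _ (mul_mem hw' (inv_mem hw)) _ (h.weyl_root w hw α hα)] at h₁
    rw [show (w' * w⁻¹) (w α) = w' α by
      rw [← LinearEquiv.mul_apply, inv_mul_cancel_right]] at h₁
    simp only [mem_insert_iff, mem_singleton_iff, div_eq_iff hne] at h₁
    rcases h₁ with h₁ | h₁ | h₁ <;> simp [h₁]
  refine ⟨fun α ↦ |co (u α α) χ|, fun α hα ↦ ⟨abs_pos.mpr (hu' α hα), ⟨_, hu α hα, rfl⟩,
    key hα (hu α hα) (hu' α hα) (one_mem _), fun w hw ↦ ?_⟩⟩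
  have hwα := h.weyl_root w hw α hα
  exact (key hα (hu α hα) (hu' α hα) (mul_mem (hu _ hwα) hw)).resolve_left (hu' _ hwα)

lemma abs_co_mul_eq_or {χ : V} {c : V → ℚ}
    (hc : ∀ α ∈ Φ, 0 < c α ∧ (∃ w ∈ weylGroup Φ co, |co (w α) χ| = c α) ∧
      (co α χ = 0 ∨ |co α χ| = c α) ∧ ∀ w ∈ weylGroup Φ co, c (w α) = c α)
    {α β : V} (hα : α ∈ Φ) (hβ : β ∈ Φ) (hβα : co β α ≠ 0) :
    |co β α| * c α = c β ∨ |co β α| * c α = 2 * c β := by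
  obtain ⟨w, hw, hwα⟩ := (hc α hα).2.1
  have hα' := h.weyl_root w hw α hα
  have hβ' := h.weyl_root w hw β hβ
  have hs := mul_mem (h.reflection_mem hα') hw
  have h₁ := h.co_reflection hα' hβ' χ
  rw [h.co_weyl_apply hw hβ, ← reflection_apply (h := h.pair_self _ hα'),
    ← LinearEquiv.mul_apply] at h₁
  have h₂ := (hc _ hβ').2.2.1
  have h₃ := (hc _ (h.weyl_root _ hs β hβ)).2.2.1
  rw [(hc β hβ).2.2.2 _ hw] at h₂
  rw [(hc β hβ).2.2.2 _ hs, h₁] at h₃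
  have h₄ : 0 < |co β α| * c α := mul_pos (abs_pos.mpr hβα) (hc α hα).1
  rw [← hwα, mul_comm, ← abs_mul] at h₄ ⊢
  generalize co (w α) χ * co β α = x at *
  grind

lemma eq_or_mul_eq_mul [FiniteDimensional ℚ V] (hspan : Submodule.span ℚ Φ = ⊤)
    (hirr : IsIrreducible Φ co) {χ : V} {c : V → ℚ}
    (hc : ∀ α ∈ Φ, 0 < c α ∧ (∃ w ∈ weylGroup Φ co, |co (w α) χ| = c α) ∧
      (co α χ = 0 ∨ |co α χ| = c α) ∧ ∀ w ∈ weylGroup Φ co, c (w α) = c α)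
    {q : V → ℚ} (hq : ∀ α ∈ Φ, ∀ w ∈ weylGroup Φ co, q (w α) = q α)
    (hco : ∀ α ∈ Φ, ∀ β ∈ Φ, co β α * q β = co α β * q α)
    {α β : V} (hα : α ∈ Φ) (hβ : β ∈ Φ) :
    c α = c β ∨ c α * q α = c β * q β := by
  obtain ⟨w, hw, hwα⟩ := h.exists_weyl_co_ne_zero hspan hirr hα hβ
  rw [← (hc α hα).2.2.2 w hw, ← hq α hα w hw]
  replace hα := h.weyl_root w hw α hα
  generalize w α = α at *
  have hne : co α β ≠ 0 := fun h₀ ↦ hwα (h.co_eq_zero_of_co_eq_zero hspan hα hβ h₀)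
  have h₁ := h.abs_co_mul_eq_or hc hα hβ hwα
  have h₂ := h.abs_co_mul_eq_or hc hβ hα hne
  have h₃ := hco α hα β hβ
  have h₄ := (hc α hα).1
  have h₅ := (hc β hβ).1
  obtain ⟨m, n, hm, hn, hmn⟩ := h.co_co_mem hspan hα hβ
  rw [hm] at h₁ h₃ hwα
  rw [hn] at h₂ h₃ hne
  simp only [mem_insert_iff, mem_singleton_iff, Prod.mk.injEq] at hmn
  rcases hmn with ⟨rfl, rfl⟩ | ⟨rfl, rfl⟩ | ⟨rfl, rfl⟩ | ⟨rfl, rfl⟩ | ⟨rfl, rfl⟩ | ⟨rfl, rfl⟩ |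
    ⟨rfl, rfl⟩ | ⟨rfl, rfl⟩ | ⟨rfl, rfl⟩ | ⟨rfl, rfl⟩ | ⟨rfl, rfl⟩ | ⟨rfl, rfl⟩ | ⟨rfl, rfl⟩ <;>
  norm_num at h₁ h₂ h₃ hwα <;> grind

end IsRootSystem

variable {Δ : Set V}

lemma IsFundCoweight.exists_nat {a : V} {e : Dual ℚ V} (he : IsFundCoweight Δ a e) :
    ∀ d ∈ Δ, ∃ n : ℕ, e d = n := by
  intro d hd
  rw [he d hd]
  split_ifs
  exacts [⟨1, by simp⟩, ⟨0, by simp⟩]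

namespace IsBase

/-- The coordinate functional of a simple root. -/
lemma exists_isFundCoweight (hΔ : IsBase Φ co Δ) (hspan : Submodule.span ℚ Φ = ⊤) {a : V}
    (ha : a ∈ Δ) : ∃ e : Dual ℚ V, IsFundCoweight Δ a e := by
  classical
  let b : Basis Δ ℚ V := .mk hΔ.indep (by simp [hΔ.span_eq, hspan])
  refine ⟨b.coord ⟨a, ha⟩, fun d hd ↦ ?_⟩
  have hbd : b ⟨d, hd⟩ = d := by simp [b]
  have : b.coord ⟨a, ha⟩ (b ⟨d, hd⟩) = if d = a then 1 else 0 := by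
    rw [b.coord_apply, b.repr_self, Finsupp.single_apply]
    simp
  rwa [hbd] at this

/-- Up to a sign, every root is a combination of simple roots with coefficients in `ℕ`. -/
lemma exists_sign (hΔ : IsBase Φ co Δ) {β : V} (hβ : β ∈ Φ) :
    ∃ ε : ℚ, (ε = 1 ∨ ε = -1) ∧
      (∀ f : Dual ℚ V, (∀ d ∈ Δ, 0 ≤ f d) → 0 ≤ ε * f β) ∧
      ∀ f : Dual ℚ V, (∀ d ∈ Δ, ∃ n : ℕ, f d = n) → ∃ n : ℕ, ε * f β = n := by
  obtain ⟨c, hc, hβ⟩ := hΔ.decomp β hβ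
  obtain ⟨ε, hε, hβ⟩ : ∃ ε : ℚ, (ε = 1 ∨ ε = -1) ∧
      ∀ f : Dual ℚ V, ε * f β = ∑ v ∈ c.support, (c v : ℚ) * f v := by
    rcases hβ with rfl | rfl
    · exact ⟨1, by simp, fun f ↦ by simp [Finsupp.sum]⟩
    · exact ⟨-1, by simp, fun f ↦ by simp [Finsupp.sum]⟩
  refine ⟨ε, hε, fun f hf ↦ ?_, fun f hf ↦ ?_⟩
  · rw [hβ]
    exact Finset.sum_nonneg fun v hv ↦ mul_nonneg (by positivity) (hf v (hc hv))
  · choose! n hn using hf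
    refine ⟨∑ v ∈ c.support, c v * n v, ?_⟩
    rw [hβ]
    push_cast
    exact Finset.sum_congr rfl fun v hv ↦ by rw [hn v (hc hv)]

/-- A dominant minuscule coweight of an irreducible root system is nonzero on at most one simple
root. -/
lemma eq_of_isMinusculeCowt [FiniteDimensional ℚ V] (hΔ : IsBase Φ co Δ) (h : IsRootSystem Φ co)
    (hirr : IsIrreducible Φ co) (hspan : Submodule.span ℚ Φ = ⊤) {f : Dual ℚ V}
    (hf : IsMinusculeCowt Φ f) (hfΔ : ∀ d ∈ Δ, 0 ≤ f d) {a b : V} (ha : a ∈ Δ) (hb : b ∈ Δ)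
    (hfa : f a = 1) (hfb : f b = 1) : a = b := by
  by_contra hab
  obtain ⟨e, he⟩ := hΔ.exists_isFundCoweight hspan ha
  obtain ⟨e', he'⟩ := hΔ.exists_isFundCoweight hspan hb
  have hea : e a = 1 := by simp [he a ha]
  have heb' : e' b = 1 := by simp [he' b hb]
  have hdisj {β : V} (hβ : β ∈ Φ) (h₁ : e β ≠ 0) : e' β = 0 := by
    by_contra h₂
    obtain ⟨ε, hε, hpos, hnat⟩ := hΔ.exists_sign hβ
    obtain ⟨m, hm⟩ := hnat e he.exists_nat
    obtain ⟨n, hn⟩ := hnat e' he'.exists_nat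
    have h₃ := hpos (f - e - e') fun d hd ↦ by
      have := hfΔ d hd
      simp only [LinearMap.sub_apply, he d hd, he' d hd]
      grind
    have hε₀ : ε ≠ 0 := by rcases hε with rfl | rfl <;> simp
    have hm' : (1 : ℚ) ≤ m := by
      rw [Nat.one_le_cast, Nat.one_le_iff_ne_zero]
      rintro rfl
      simp [hε₀, h₁] at hm
    have hn' : (1 : ℚ) ≤ n := by
      rw [Nat.one_le_cast, Nat.one_le_iff_ne_zero]
      rintro rfl
      simp [hε₀, h₂] at hn
    have h₄ : ε * f β ≤ 1 := by
      rcases hε with rfl | rfl <;> rcases hf β hβ with h₅ | h₅ | h₅ <;> rw [h₅] <;> norm_num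
    simp only [LinearMap.sub_apply, mul_sub] at h₃
    linarith
  have horth {β : V} (hβ : β ∈ Φ) (h₁ : e β ≠ 0) : co b β = 0 := by
    have h₂ := hdisj (h.refl_mem b (hΔ.subset hb) β hβ)
    have heb : e b = 0 := by simp [he b hb, Ne.symm hab]
    simpa [heb, h₁, heb', hdisj hβ h₁] using h₂
  let U := Submodule.span ℚ {β ∈ Φ | e β ≠ 0}
  have hbU : U ≤ LinearMap.ker (co b) := Submodule.span_le.mpr fun β hβ ↦ horth hβ.1 hβ.2
  have haU : a ∈ U := Submodule.subset_span ⟨hΔ.subset ha, by simp [hea]⟩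
  have hΨ := hirr.2 (Φ ∩ U) inter_subset_left ?_
  · rcases hΨ with hΨ | hΨ
    · exact hΨ.subset ⟨hΔ.subset ha, haU⟩
    · have h₁ : co b b = 0 := hbU (hΨ.symm.subset (hΔ.subset hb)).2
      simp [h.pair_self b (hΔ.subset hb)] at h₁
  · rintro α ⟨hα, hαU⟩ γ ⟨hγ, hγU⟩
    replace hγU : γ ∉ U := fun h₁ ↦ hγU ⟨hγ, h₁⟩
    have heγ : e γ = 0 := by
      by_contra h₁
      exact hγU (Submodule.subset_span ⟨hγ, h₁⟩)
    have h₁ : U ≤ LinearMap.ker (co γ) := Submodule.span_le.mpr fun β hβ ↦ by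
      have h₂ : β - co γ β • γ ∈ U :=
        Submodule.subset_span ⟨h.refl_mem γ hγ β hβ.1, by simpa [heγ] using hβ.2⟩
      by_contra h₃
      rw [U.sub_mem_iff_right (Submodule.subset_span hβ), U.smul_mem_iff h₃] at h₂
      exact hγU h₂
    exact h.co_eq_zero_of_co_eq_zero hspan hγ hα (h₁ hαU)

end IsBase

lemma div_mem_of_mem {x y : ℚ} (hx : x ∈ ({-1, 0, 1} : Set ℚ)) (hy : y ∈ ({-1, 0, 1} : Set ℚ)) :
    x / y ∈ ({-1, 0, 1} : Set ℚ) := by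
  rcases hx with rfl | rfl | rfl <;> rcases hy with rfl | rfl | rfl <;> simp

lemma IsMinuscule.isQuasiConstant_smul {χ : V} (hχ : IsMinuscule Φ co χ)
    (h : IsRootSystem Φ co) (m : ℚ) : IsQuasiConstant Φ co (m • χ) := by
  intro α hα hne σ hσ
  rw [map_smul, smul_eq_mul] at hne
  rw [← h.weyl_coroot σ hσ α hα, map_smul, map_smul, smul_eq_mul, smul_eq_mul,
    mul_div_mul_left _ _ (left_ne_zero_of_mul hne)]
  exact div_mem_of_mem (hχ _ (h.weyl_root σ hσ α hα)) (hχ α hα)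

lemma IsMinuscule.mem_weightLattice {χ : V} (hχ : IsMinuscule Φ co χ) :
    χ ∈ weightLattice Φ co := by
  intro β hβ
  rcases hχ β hβ with h | h | h <;> rw [h]
  exacts [⟨-1, by simp⟩, ⟨0, by simp⟩, ⟨1, by simp⟩]

lemma IsCominuscule.isQuasiConstant_smul [FiniteDimensional ℚ V] {χ : V}
    (hχ : IsCominuscule Φ co χ) (h : IsRootSystem Φ co) (hspan : Submodule.span ℚ Φ = ⊤) (m : ℚ) :
    IsQuasiConstant Φ co (m • χ) := by
  obtain ⟨-, Δ, hΔ, a, ha, hχ, hmin⟩ := hχ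
  obtain ⟨B, -, hBw, hBpos, hB⟩ := h.exists_form hspan
  have hBa := (hBpos a (hΔ.subset ha)).ne'
  let f : Dual ℚ V := (2 / B a a) • B χ
  have hf {β : V} (hβ : β ∈ Φ) : f β = co β χ * (B β β / B a a) := by
    change 2 / B a a * B χ β = _
    rw [div_mul_eq_mul_div, hB β hβ, mul_div_assoc]
  have hfmin : IsMinusculeCowt Φ f := hmin f fun d hd ↦ by
    rw [hf (hΔ.subset hd), hχ d hd]
    split_ifs with hda
    · rw [hda, div_self hBa, one_mul]
    · rw [zero_mul]
  intro α hα hne σ hσ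
  have hσα := h.weyl_root σ hσ α hα
  rw [map_smul, smul_eq_mul] at hne
  have key : co (σ α) χ / co α χ = f (σ α) / f α := by
    rw [hf hσα, hf hα, hBw σ hσ, mul_div_mul_right _ _ (div_ne_zero (hBpos α hα).ne' hBa)]
  rw [← h.weyl_coroot σ hσ α hα, map_smul, map_smul, smul_eq_mul, smul_eq_mul,
    mul_div_mul_left _ _ (left_ne_zero_of_mul hne), key]
  exact div_mem_of_mem (hfmin _ hσα) (hfmin α hα)

lemma exists_isCominuscule [FiniteDimensional ℚ V] (h : IsRootSystem Φ co)
    (hirr : IsIrreducible Φ co) (hspan : Submodule.span ℚ Φ = ⊤) {χ : V}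
    (hχ : χ ∈ weightLattice Φ co) {q : V → ℚ} (hq : ∀ α ∈ Φ, q α ≠ 0) {f : Dual ℚ V}
    (hf : IsMinusculeCowt Φ f) (hfχ : ∀ α ∈ Φ, f α = co α χ * q α)
    (hne : ∃ α ∈ Φ, co α χ ≠ 0) :
    ∃ (m : ℤ) (χ₀ : V), χ₀ ∈ weightLattice Φ co ∧ χ = (m : ℚ) • χ₀ ∧
      IsCominuscule Φ co χ₀ := by
  obtain ⟨Δ, hΔ, hfΔ, hint⟩ := h.exists_isBase_nonneg hspan hf
  have hspanΔ : Submodule.span ℚ Δ = ⊤ := hΔ.span_eq.trans hspan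
  obtain ⟨a, ha, hfa⟩ : ∃ a ∈ Δ, f a ≠ 0 := by
    by_contra! hΔ₀
    obtain ⟨α, hα, hαχ⟩ := hne
    have : f = 0 := LinearMap.ext_on hspanΔ fun d hd ↦ hΔ₀ d hd
    exact mul_ne_zero hαχ (hq α hα) (by rw [← hfχ α hα, this, LinearMap.zero_apply])
  have hone {d : V} (hd : d ∈ Δ) (hfd : f d ≠ 0) : f d = 1 := by
    have h₁ := hfΔ d hd
    rcases hf d (hΔ.subset hd) with h₂ | h₂ | h₂
    · norm_num [h₂] at h₁
    · exact absurd h₂ hfd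
    · exact h₂
  have hzero {d : V} (hd : d ∈ Δ) (hda : d ≠ a) : f d = 0 := by
    by_contra hfd
    exact hda (hΔ.eq_of_isMinusculeCowt h hirr hspan hf hfΔ hd ha (hone hd hfd) (hone ha hfa))
  obtain ⟨m, hm⟩ := hχ a (hΔ.subset ha)
  have hm₀ : (m : ℚ) ≠ 0 := by
    rw [hfχ a (hΔ.subset ha), hm] at hfa
    exact left_ne_zero_of_mul hfa
  have hfund : IsFundWeight co Δ a ((m : ℚ)⁻¹ • χ) := by
    intro d hd
    rw [map_smul, smul_eq_mul]
    split_ifs with hda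
    · rw [hda, hm, inv_mul_cancel₀ hm₀]
    · have h₁ := hzero hd hda
      rw [hfχ d (hΔ.subset hd)] at h₁
      rw [(mul_eq_zero_iff_right (hq d (hΔ.subset hd))).mp h₁, mul_zero]
  refine ⟨m, (m : ℚ)⁻¹ • χ, fun β hβ ↦ ?_, (smul_inv_smul₀ hm₀ χ).symm, by simp [hspan],
    Δ, hΔ, a, ha, hfund, fun f' hf' ↦ ?_⟩
  · have hβΔ := hint β hβ
    generalize co β = g at hβΔ ⊢
    induction hβΔ using Submodule.span_induction with
    | mem g hg =>
      obtain ⟨d, hd, rfl⟩ := hg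
      rw [hfund d hd]
      split_ifs
      exacts [⟨1, by simp⟩, ⟨0, by simp⟩]
    | zero => exact ⟨0, by simp⟩
    | add g g' _ _ hg hg' =>
      obtain ⟨n, hn⟩ := hg
      obtain ⟨n', hn'⟩ := hg'
      exact ⟨n + n', by rw [LinearMap.add_apply, hn, hn', Int.cast_add]⟩
    | smul k g _ hg =>
      obtain ⟨n, hn⟩ := hg
      exact ⟨k * n, by rw [LinearMap.smul_apply, hn, zsmul_eq_mul, Int.cast_mul]⟩
  · have : f' = f := LinearMap.ext_on hspanΔ fun d hd ↦ by
      rw [hf' d hd]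
      split_ifs with hda
      · rw [hda, hone ha hfa]
      · rw [hzero hd hda]
    rwa [this]

lemma IsQuasiConstant.exists_eq_smul [FiniteDimensional ℚ V] {χ : V}
    (hqc : IsQuasiConstant Φ co χ) (h : IsRootSystem Φ co) (hirr : IsIrreducible Φ co)
    (hspan : Submodule.span ℚ Φ = ⊤) (hχ : χ ∈ weightLattice Φ co) :
    ∃ (m : ℤ) (χ₀ : V), χ₀ ∈ weightLattice Φ co ∧ χ = (m : ℚ) • χ₀ ∧
      (IsMinuscule Φ co χ₀ ∨ IsCominuscule Φ co χ₀) := by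
  by_cases hne : ∃ α ∈ Φ, co α χ ≠ 0
  swap
  · push Not at hne
    exact ⟨1, χ, hχ, by simp, .inl fun α hα ↦ by simp [hne α hα]⟩
  obtain ⟨c, hc⟩ := h.exists_quasiConstant_abs hirr hne hqc
  obtain ⟨B, hBsymm, hBw, hBpos, hB⟩ := h.exists_form hspan
  have hcq {α β : V} (hα : α ∈ Φ) (hβ : β ∈ Φ) :=
    h.eq_or_mul_eq_mul hspan hirr hc (q := fun α ↦ B α α) (fun α _ w hw ↦ hBw w hw α α)
      (fun α hα β hβ ↦ by rw [← hB β hβ, ← hB α hα, hBsymm]) hα hβ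
  have hmem {x t : ℚ} (ht : 0 < t) (hx : x = 0 ∨ |x| = t) : t⁻¹ * x ∈ ({-1, 0, 1} : Set ℚ) := by
    rcases hx with rfl | hx
    · simp
    · rcases eq_or_eq_neg_of_abs_eq hx with rfl | rfl
      · simp [ht.ne']
      · simp [ht.ne']
  by_cases hconst : ∀ α ∈ Φ, ∀ β ∈ Φ, c α = c β
  · obtain ⟨α, hα⟩ := hirr.1
    obtain ⟨hpos, ⟨w, hw, hwα⟩, -⟩ := hc α hα
    obtain ⟨n, hn⟩ := hχ _ (h.weyl_root w hw α hα)
    have hcn : ((|n| : ℤ) : ℚ) = c α := by rw [← hwα, hn, Int.cast_abs]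
    have hmin : IsMinuscule Φ co ((c α)⁻¹ • χ) := fun β hβ ↦ by
      rw [map_smul, smul_eq_mul]
      exact hmem hpos (hconst α hα β hβ ▸ (hc β hβ).2.2.1)
    exact ⟨|n|, _, hmin.mem_weightLattice, by rw [hcn, smul_inv_smul₀ hpos.ne'], .inl hmin⟩
  · push Not at hconst
    obtain ⟨α, hα, β, hβ, hαβ⟩ := hconst
    have hconst' {γ : V} (hγ : γ ∈ Φ) : c γ * B γ γ = c α * B α α := by
      have := hcq hα hβ
      have := hcq hα hγ
      have := hcq hβ hγ
      grind
    have hpos := mul_pos (hc α hα).1 (hBpos α hα)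
    set k := c α * B α α
    have hf {γ : V} (hγ : γ ∈ Φ) : ((2 * k⁻¹) • B χ) γ = co γ χ * (k⁻¹ * B γ γ) := by
      rw [LinearMap.smul_apply, smul_eq_mul]
      linear_combination k⁻¹ * hB γ hγ χ
    obtain ⟨m, χ₀, h₁, h₂, h₃⟩ := exists_isCominuscule h hirr hspan hχ
      (q := fun γ ↦ k⁻¹ * B γ γ) (fun γ hγ ↦ mul_ne_zero (inv_ne_zero hpos.ne') (hBpos γ hγ).ne')
      (f := (2 * k⁻¹) • B χ) (fun γ hγ ↦ by
        rw [hf hγ, mul_left_comm]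
        refine hmem hpos ((hc γ hγ).2.2.1.imp (fun h₀ ↦ by simp [h₀]) fun h₀ ↦ ?_)
        rw [abs_mul, h₀, abs_of_pos (hBpos γ hγ), hconst' hγ])
      (fun γ hγ ↦ hf hγ) hne
    exact ⟨m, χ₀, h₁, h₂, .inr h₃⟩

end RootSystem

end QC


/-- Theorem 1.4 of the paper, character case. Let `Φ` be a reduced
irreducible root system spanning `V`, with weight lattice `P`. An element `χ ∈ P` is
quasi-constant if and only if there exist an integer `m` and `χ₀ ∈ P` such that
`χ = m • χ₀` and `χ₀` is either minuscule or cominuscule. -/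
theorem statement0 {V : Type*} [AddCommGroup V] [Module ℚ V] [FiniteDimensional ℚ V]
    (Φ : Set V) (co : V → Module.Dual ℚ V)
    (hRS : QC.IsRootSystem Φ co) (hirr : QC.IsIrreducible Φ co)
    (hspan : Submodule.span ℚ Φ = ⊤)
    (χ : V) (hχ : χ ∈ QC.weightLattice Φ co) :
    QC.IsQuasiConstant Φ co χ ↔
      ∃ (m : ℤ) (χ₀ : V), χ₀ ∈ QC.weightLattice Φ co ∧ χ = (m : ℚ) • χ₀ ∧
        (QC.IsMinuscule Φ co χ₀ ∨ QC.IsCominuscule Φ co χ₀) := by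
  refine ⟨fun hqc ↦ hqc.exists_eq_smul hRS hirr hspan hχ, ?_⟩
  rintro ⟨m, χ₀, -, rfl, hχ₀ | hχ₀⟩
  · exact hχ₀.isQuasiConstant_smul hRS m
  · exact hχ₀.isQuasiConstant_smul hRS hspan m
end

section
/- Let Φ span V, let Φ = Φ₁ ⊥ ⋯ ⊥ Φ_d be the decomposition into irreducible components with V = V₁ ⊕ ⋯ ⊕ V_d, and let Γ act on the root datum by automorphisms, acting transitively on the set of components {Φ₁, …, Φ_d}. For χ in the weight lattice P write χ = (χ₁, …, χ_d) with χ_i ∈ V_i. Then χ is quasi-constant with respect to W⋊Γ if and only if there exist an integer m ≥ 1 and elements ξ_i in the weight lattice of Φ_i (1 ≤ i ≤ d) such that: χ_i = m·ξ_i for all i; every ξ_i is either zero, minuscule, or cominuscule (for the root system Φ_i); and the nonzero ξ_j are either all minuscule or all cominuscule. -/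
namespace QC

variable {V : Type*} [AddCommGroup V] [Module ℚ V]

/-- A reduced crystallographic root system `Ψ` with coroots `co`, together with a positive definite
form `B` inducing the coroots by `⟨x, α∨⟩ = 2 (α, x) / (α, α)`. -/
structure IsEuclidean (Ψ : Set V) (co : V → Module.Dual ℚ V)
    (B : LinearMap.BilinForm ℚ V) : Prop where
  finite : Ψ.Finite
  symm : ∀ x y, B x y = B y x
  pos : ∀ x, x ≠ 0 → 0 < B x x
  ne_zero : ∀ α ∈ Ψ, α ≠ 0
  co_mul : ∀ α ∈ Ψ, ∀ x, co α x * B α α = 2 * B α x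
  pair_int : ∀ α ∈ Ψ, ∀ β ∈ Ψ, ∃ n : ℤ, co α β = n
  refl_mem : ∀ α ∈ Ψ, ∀ β ∈ Ψ, β - co α β • α ∈ Ψ
  reduced : ∀ α ∈ Ψ, ∀ c : ℚ, c • α ∈ Ψ → c = 1 ∨ c = -1

namespace IsEuclidean

variable {Ψ : Set V} {co : V → Module.Dual ℚ V} {B : LinearMap.BilinForm ℚ V}

lemma norm_pos (h : IsEuclidean Ψ co B) {α : V} (hα : α ∈ Ψ) : 0 < B α α :=
  h.pos α (h.ne_zero α hα)

lemma co_self (h : IsEuclidean Ψ co B) {α : V} (hα : α ∈ Ψ) : co α α = 2 :=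
  mul_right_cancel₀ (h.norm_pos hα).ne' (h.co_mul α hα α)

lemma co_eq_zero_iff (h : IsEuclidean Ψ co B) {α : V} (hα : α ∈ Ψ) (x : V) :
    co α x = 0 ↔ B α x = 0 := by
  have h1 := h.co_mul α hα x
  have h2 := h.norm_pos hα
  constructor
  · intro h0
    rw [h0] at h1
    linarith
  · intro h0
    rw [h0, mul_zero] at h1
    exact (mul_eq_zero.mp h1).resolve_right h2.ne'

lemma co_pos_iff (h : IsEuclidean Ψ co B) {α : V} (hα : α ∈ Ψ) (x : V) :
    0 < co α x ↔ 0 < B α x := by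
  rw [← mul_pos_iff_of_pos_right (h.norm_pos hα), h.co_mul α hα]
  constructor <;> intro _ <;> linarith

lemma neg_mem (h : IsEuclidean Ψ co B) {α : V} (hα : α ∈ Ψ) : -α ∈ Ψ := by
  have := h.refl_mem α hα α hα
  rwa [h.co_self hα, two_smul, sub_add_cancel_left] at this

lemma norm_refl (h : IsEuclidean Ψ co B) {α : V} (hα : α ∈ Ψ) (x : V) :
    B (x - co α x • α) (x - co α x • α) = B x x := by
  have h1 := h.co_mul α hα x
  have h2 := h.symm x α
  simp only [map_sub, map_smul, LinearMap.sub_apply, LinearMap.smul_apply, smul_eq_mul]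
  rw [h2]
  linear_combination (co α x) * h1

/-- Two non-obtuse roots are equal, or the longer one has coroot value `1` on the shorter one. -/
lemma eq_or_pairing (h : IsEuclidean Ψ co B) {α β : V} (hα : α ∈ Ψ) (hβ : β ∈ Ψ)
    (hB : 0 < B α β) (hle : B β β ≤ B α α) :
    α = β ∨ (co α β = 1 ∧ (co β α = 1 ∨ co β α = 2 ∨ co β α = 3)) := by
  obtain ⟨q, hq⟩ := h.pair_int α hα β hβ
  obtain ⟨p, hp⟩ := h.pair_int β hβ α hα
  have hNα := h.norm_pos hα
  have hNβ := h.norm_pos hβ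
  have e1 := h.co_mul α hα β
  have e2 := h.co_mul β hβ α
  rw [h.symm β α] at e2
  have hq0 : 0 < co α β := (h.co_pos_iff hα β).2 hB
  have hp0 : 0 < co β α := (h.co_pos_iff hβ α).2 (by rwa [h.symm])
  have hqp : co α β ≤ co β α := by
    by_contra hlt
    push Not at hlt
    nlinarith
  have hx : B ((2 : ℚ) • β - co α β • α) ((2 : ℚ) • β - co α β • α)
      = (4 - co β α * co α β) * B β β := by
    simp only [map_sub, map_smul, LinearMap.sub_apply, LinearMap.smul_apply, smul_eq_mul]
    rw [h.symm β α]
    linear_combination (co α β) * e1 + (co α β) * e2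
  by_cases h0 : (2 : ℚ) • β - co α β • α = 0
  · left
    have hb : β = (co α β / 2) • α := by
      have h3 : (2 : ℚ) • β = co α β • α := sub_eq_zero.mp h0
      rw [div_eq_inv_mul, mul_smul, ← h3, smul_smul]
      norm_num
    rcases h.reduced α hα (co α β / 2) (hb ▸ hβ) with h4 | h4
    · rw [h4, one_smul] at hb
      exact hb.symm
    · linarith
  · right
    have h5 := h.pos _ h0
    rw [hx] at h5
    have h6 : 0 < 4 - co β α * co α β := (mul_pos_iff_of_pos_right hNβ).1 h5
    rw [hq, hp] at *
    norm_cast at hq0 hp0 hqp ⊢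
    have h7 : p * q < 4 := by
      have : (p : ℚ) * q < 4 := by linarith
      exact_mod_cast this
    have hq1 : q = 1 := by nlinarith
    subst hq1
    refine ⟨rfl, ?_⟩
    omega

lemma root_sub_mem (h : IsEuclidean Ψ co B) {α β : V} (hα : α ∈ Ψ) (hβ : β ∈ Ψ)
    (hB : 0 < B α β) (hne : α ≠ β) : α - β ∈ Ψ := by
  rcases le_total (B β β) (B α α) with hle | hle
  · have h1 := ((h.eq_or_pairing hα hβ hB hle).resolve_left hne).1
    have h2 := h.refl_mem α hα β hβ
    rw [h1, one_smul] at h2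
    simpa using h.neg_mem h2
  · have h1 := ((h.eq_or_pairing hβ hα (by rwa [h.symm]) hle).resolve_left hne.symm).1
    have h2 := h.refl_mem β hβ α hα
    rwa [h1, one_smul] at h2

lemma root_add_mem (h : IsEuclidean Ψ co B) {α β : V} (hα : α ∈ Ψ) (hβ : β ∈ Ψ)
    (hB : B α β < 0) (hne : α ≠ -β) : α + β ∈ Ψ := by
  have := h.root_sub_mem hα (h.neg_mem hβ) (by simpa using hB) hne
  rwa [sub_neg_eq_add] at this

/-- A subspace stable under all reflections and containing a root contains all roots. -/
lemma subset_of_stable (h : IsEuclidean Ψ co B) (hirr : IsIrreducible Ψ co)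
    (U : Submodule ℚ V) (hU : ∀ γ ∈ Ψ, ∀ u ∈ U, co γ u • γ ∈ U) {α : V} (hα : α ∈ Ψ)
    (hαU : α ∈ U) : Ψ ⊆ U := by
  have horth : ∀ δ ∈ Ψ ∩ U, ∀ β ∈ Ψ \ (Ψ ∩ U), co δ β = 0 := by
    rintro δ ⟨hδ, hδU⟩ β ⟨hβ, hβU⟩
    rw [h.co_eq_zero_iff hδ, h.symm, ← h.co_eq_zero_iff hβ]
    by_contra hne
    exact hβU ⟨hβ, (U.smul_mem_iff hne).1 (hU β hβ δ hδU)⟩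
  rcases hirr.2 (Ψ ∩ U) Set.inter_subset_left horth with h1 | h1
  · exact absurd (show α ∈ Ψ ∩ U from ⟨hα, hαU⟩) (by simp [h1])
  · exact Set.inter_eq_left.mp h1

/-- The version of `subset_of_stable` for the span of a set of vectors. -/
lemma subset_span (h : IsEuclidean Ψ co B) (hirr : IsIrreducible Ψ co)
    (S : Set V) (hS : ∀ γ ∈ Ψ, ∀ u ∈ S, co γ u • γ ∈ Submodule.span ℚ S) {α : V} (hα : α ∈ Ψ)
    (hαS : α ∈ S) : Ψ ⊆ Submodule.span ℚ S := by
  refine h.subset_of_stable hirr _ (fun γ hγ u hu ↦ ?_) hα (Submodule.subset_span hαS)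
  induction hu using Submodule.span_induction with
  | mem x hx => exact hS γ hγ x hx
  | zero => simp
  | add x y _ _ hx hy =>
    rw [map_add, add_smul]
    exact add_mem hx hy
  | smul c x _ hx =>
    rw [map_smul, smul_assoc]
    exact Submodule.smul_mem _ _ hx

/-- A vector orthogonal to a nonempty reflection-stable set of roots is orthogonal to all roots. -/
lemma exists_mem_ne_zero (h : IsEuclidean Ψ co B) (hirr : IsIrreducible Ψ co) {S : Set V}
    (hS : ∀ γ ∈ Ψ, ∀ u ∈ S, u - co γ u • γ ∈ S) {α : V} (hα : α ∈ Ψ) (hαS : α ∈ S)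
    {x β : V} (hβ : β ∈ Ψ) (hx : B β x ≠ 0) : ∃ γ ∈ S, B γ x ≠ 0 := by
  by_contra hcon
  push Not at hcon
  have hsub := h.subset_span hirr S (fun γ hγ u hu ↦ by
    have h2 := Submodule.sub_mem _ (Submodule.subset_span (R := ℚ) hu)
      (Submodule.subset_span (R := ℚ) (hS γ hγ u hu))
    rwa [sub_sub_cancel] at h2) hα hαS
  have hker : Submodule.span ℚ S ≤ LinearMap.ker (B.flip x) := by
    rw [Submodule.span_le]
    intro γ hγ
    simpa using hcon γ hγ
  exact hx (by simpa using hker (hsub hβ))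

lemma exists_norm_eq_ne_zero (h : IsEuclidean Ψ co B) (hirr : IsIrreducible Ψ co)
    {α : V} (hα : α ∈ Ψ) {x β : V} (hβ : β ∈ Ψ) (hx : B β x ≠ 0) :
    ∃ γ ∈ Ψ, B γ γ = B α α ∧ B γ x ≠ 0 := by
  obtain ⟨γ, ⟨hγ, hγ'⟩, h0⟩ := h.exists_mem_ne_zero hirr (S := {γ | γ ∈ Ψ ∧ B γ γ = B α α})
    (fun γ hγ u hu ↦ ⟨h.refl_mem γ hγ u hu.1, (h.norm_refl hγ u).trans hu.2⟩) hα ⟨hα, rfl⟩ hβ hx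
  exact ⟨γ, hγ, hγ', h0⟩

/-- The indecomposable elements among the roots on which `f` is positive. -/
def simpleRoots (Ψ : Set V) (f : Module.Dual ℚ V) : Set V :=
  {δ | δ ∈ Ψ ∧ 0 < f δ ∧ ∀ β ∈ Ψ, ∀ γ ∈ Ψ, 0 < f β → 0 < f γ → δ ≠ β + γ}

lemma mem_closure_simpleRoots (h : IsEuclidean Ψ co B) (f : Module.Dual ℚ V) {α : V}
    (hα : α ∈ Ψ) (hf : 0 < f α) : α ∈ AddSubmonoid.closure (simpleRoots Ψ f) := by
  by_contra hcon
  let S : Set V := {β | β ∈ Ψ ∧ 0 < f β ∧ β ∉ AddSubmonoid.closure (simpleRoots Ψ f)}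
  have hfin : S.Finite := h.finite.subset fun _ hx ↦ hx.1
  obtain ⟨β, ⟨hβ, hβ0, hβS⟩, hmin⟩ := hfin.exists_minimalFor f S ⟨α, hα, hf, hcon⟩
  have hdec : ¬ ∀ x ∈ Ψ, ∀ y ∈ Ψ, 0 < f x → 0 < f y → β ≠ x + y := fun hall ↦
    hβS (AddSubmonoid.subset_closure ⟨hβ, hβ0, hall⟩)
  push Not at hdec
  obtain ⟨x, hx, y, hy, hx0, hy0, rfl⟩ := hdec
  have key : ∀ z ∈ Ψ, 0 < f z → f z < f (x + y) →
      z ∈ AddSubmonoid.closure (simpleRoots Ψ f) := by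
    intro z hz hz0 hlt
    by_contra hzS
    exact absurd (hmin ⟨hz, hz0, hzS⟩ hlt.le) (not_le.2 hlt)
  refine hβS (add_mem (key x hx hx0 ?_) (key y hy hy0 ?_)) <;> rw [map_add] <;> linarith

lemma simpleRoots_obtuse (h : IsEuclidean Ψ co B) (f : Module.Dual ℚ V)
    (hf : ∀ α ∈ Ψ, f α ≠ 0) {α β : V} (hα : α ∈ simpleRoots Ψ f) (hβ : β ∈ simpleRoots Ψ f)
    (hne : α ≠ β) : B α β ≤ 0 := by
  by_contra hcon
  push Not at hcon
  have hsub := h.root_sub_mem hα.1 hβ.1 hcon hne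
  rcases lt_or_gt_of_ne (hf _ hsub) with hlt | hgt
  · refine hβ.2.2 _ (h.neg_mem hsub) α hα.1 ?_ hα.2.1 (by abel)
    rw [map_neg]
    linarith
  · exact hα.2.2 _ hsub β hβ.1 hgt hβ.2.1 (by abel)

lemma exists_finsupp_of_mem_closure {S : Set V} {x : V} (hx : x ∈ AddSubmonoid.closure S) :
    ∃ c : V →₀ ℕ, ↑c.support ⊆ S ∧ x = c.sum (fun v n => (n : ℚ) • v) := by
  induction hx using AddSubmonoid.closure_induction with
  | mem x hx =>
    refine ⟨Finsupp.single x 1, ?_, by simp⟩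
    intro y hy
    have := Finsupp.support_single_subset hy
    simp only [Finset.mem_singleton] at this
    exact this ▸ hx
  | zero => exact ⟨0, by simp, by simp⟩
  | add x y _ _ hx hy =>
    obtain ⟨c, hc, rfl⟩ := hx
    obtain ⟨e, he, rfl⟩ := hy
    classical
    refine ⟨c + e, fun z hz ↦ ?_, ?_⟩
    · rcases Finset.mem_union.1 (Finsupp.support_add hz) with h1 | h1
      · exact hc h1
      · exact he h1
    · rw [Finsupp.sum_add_index'] <;> simp [add_smul]

lemma isBase_simpleRoots (h : IsEuclidean Ψ co B) (f : Module.Dual ℚ V)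
    (hf : ∀ α ∈ Ψ, f α ≠ 0) : IsBase Ψ co (simpleRoots Ψ f) where
  subset := fun _ hx ↦ hx.1
  indep := by
    refine LinearMap.BilinForm.linearIndependent_of_pairwise_le_zero B
      (fun x hx ↦ by simpa using h.pos x hx) f _ (fun i ↦ i.2.2.1) ?_
    intro i j hij
    exact h.simpleRoots_obtuse f hf i.2 j.2 (fun e ↦ hij (Subtype.ext e))
  span_eq := by
    refine le_antisymm (Submodule.span_mono fun _ hx ↦ hx.1) (Submodule.span_le.2 fun x hx ↦ ?_)
    have hcl : ∀ y ∈ Ψ, 0 < f y → y ∈ Submodule.span ℚ (simpleRoots Ψ f) := fun y hy hy0 ↦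
      AddSubmonoid.closure_le (S := (Submodule.span ℚ (simpleRoots Ψ f)).toAddSubmonoid).2
        Submodule.subset_span (h.mem_closure_simpleRoots f hy hy0)
    rcases lt_or_gt_of_ne (hf x hx) with hlt | hgt
    · exact (Submodule.neg_mem_iff _).1 (hcl _ (h.neg_mem hx) (by simpa using hlt))
    · exact hcl x hx hgt
  decomp := by
    intro α hα
    rcases lt_or_gt_of_ne (hf α hα) with hlt | hgt
    · obtain ⟨c, hc, he⟩ := exists_finsupp_of_mem_closure
        (h.mem_closure_simpleRoots f (h.neg_mem hα) (by simpa using hlt))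
      exact ⟨c, hc, Or.inr (by rw [← he, neg_neg])⟩
    · obtain ⟨c, hc, he⟩ := exists_finsupp_of_mem_closure (h.mem_closure_simpleRoots f hα hgt)
      exact ⟨c, hc, Or.inl he⟩

/-- A functional separating a root system, positive wherever the minuscule coweight `μ` is. -/
lemma exists_regular (h : IsEuclidean Ψ co B) {μ : Module.Dual ℚ V}
    (hμ : IsMinusculeCowt Ψ μ) :
    ∃ f : Module.Dual ℚ V, (∀ β ∈ Ψ, f β ≠ 0) ∧ ∀ β ∈ Ψ, μ β = 1 → 0 < f β := by
  have := h.finite.to_subtype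
  obtain ⟨g, hg⟩ := Module.exists_dual_forall_apply_ne_zero (K := ℚ) (fun i : Ψ ↦ (i : V))
    (fun i ↦ h.ne_zero i i.2)
  obtain ⟨N, hN⟩ := (h.finite.image fun β ↦ |g β|).bddAbove
  have hN' : ∀ β ∈ Ψ, |g β| < N + 1 := fun β hβ ↦
    (hN (Set.mem_image_of_mem _ hβ)).trans_lt (lt_add_one N)
  refine ⟨(N + 1) • μ + g, fun β hβ ↦ ?_, fun β hβ h1 ↦ ?_⟩
  · have h2 := abs_lt.1 (hN' β hβ)
    have h3 := hg ⟨β, hβ⟩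
    simp only [LinearMap.add_apply, LinearMap.smul_apply, smul_eq_mul]
    rcases hμ β hβ with h1 | h1 | h1
    · rw [h1]
      linarith
    · rw [h1]
      simpa using h3
    · rw [Set.mem_singleton_iff] at h1
      rw [h1]
      linarith
  · have h2 := abs_lt.1 (hN' β hβ)
    simp only [LinearMap.add_apply, LinearMap.smul_apply, smul_eq_mul, h1]
    linarith

/-- A nonzero minuscule coweight of an irreducible root system is the fundamental coweight, with
respect to a suitable base, of a simple root which is longest among the roots on which the coweight
does not vanish. -/
theorem exists_base_of_isMinusculeCowt (h : IsEuclidean Ψ co B) (hirr : IsIrreducible Ψ co)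
    {μ : Module.Dual ℚ V} (hμ : IsMinusculeCowt Ψ μ) {α₀ : V} (hα₀ : α₀ ∈ Ψ) (hμ₀ : μ α₀ ≠ 0) :
    ∃ Δ, IsBase Ψ co Δ ∧ ∃ α ∈ Δ, IsFundCoweight Δ α μ ∧
      ∀ β ∈ Ψ, μ β ≠ 0 → B β β ≤ B α α := by
  obtain ⟨f, hf, hfμ⟩ := h.exists_regular hμ
  have hbase := h.isBase_simpleRoots f hf
  set Δ := simpleRoots Ψ f
  have hμ' : ∀ β ∈ Ψ, μ β = -1 ∨ μ β = 0 ∨ μ β = 1 := hμ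
  have hsimple : ∀ δ ∈ Δ, μ δ = 0 ∨ μ δ = 1 := by
    intro δ hδ
    refine (hμ' δ hδ.1).resolve_left fun h1 ↦ ?_
    have h2 := hfμ (-δ) (h.neg_mem hδ.1) (by rw [map_neg, h1, neg_neg])
    have h3 := hδ.2.1
    rw [map_neg] at h2
    linarith
  have hpm : ∀ β ∈ Ψ, μ β ≠ 0 → ∃ β' ∈ Ψ, μ β' = 1 ∧ B β' β' = B β β := by
    intro β hβ hβ0
    rcases hμ' β hβ with h1 | h1 | h1
    · exact ⟨-β, h.neg_mem hβ, by rw [map_neg, h1, neg_neg], by simp⟩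
    · exact absurd h1 hβ0
    · exact ⟨β, hβ, h1, rfl⟩
  have hcl : ∀ β ∈ Ψ, μ β = 1 → β ∈ AddSubmonoid.closure Δ := fun β hβ h1 ↦
    h.mem_closure_simpleRoots f hβ (hfμ β hβ h1)
  obtain ⟨α, hα, hα1⟩ : ∃ α ∈ Δ, μ α = 1 := by
    by_contra hcon
    push Not at hcon
    obtain ⟨β, hβ, hβ1, -⟩ := hpm α₀ hα₀ hμ₀
    have hle : AddSubmonoid.closure Δ ≤ AddMonoidHom.mker μ.toAddMonoidHom :=
      AddSubmonoid.closure_le.2 fun δ hδ ↦ (hsimple δ hδ).resolve_right (hcon δ hδ)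
    have h0 : μ β = 0 := hle (hcl β hβ hβ1)
    rw [h0] at hβ1
    exact zero_ne_one hβ1
  have huniq : ∀ δ ∈ Δ, δ ≠ α → μ δ = 0 := by
    intro δ₀ hδ₀ hne
    refine (hsimple δ₀ hδ₀).resolve_right fun hδ₁ ↦ ?_
    classical
    obtain ⟨g, hg⟩ : ∃ g : Module.Dual ℚ V, ∀ δ ∈ Δ, g δ = if δ = α then 1 else 0 := by
      let b := Module.Basis.extend hbase.indep
      refine ⟨b.constr ℚ fun i ↦ if (i : V) = α then 1 else 0, fun δ hδ ↦ ?_⟩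
      have h1 := b.constr_basis ℚ (fun i ↦ if (i : V) = α then (1 : ℚ) else 0)
        ⟨δ, Module.Basis.subset_extend hbase.indep hδ⟩
      rwa [show b _ = δ from Module.Basis.extend_apply_self _ _] at h1
    have hgcl : ∀ x ∈ AddSubmonoid.closure Δ, (∃ n : ℕ, g x = n) ∧ g x ≤ μ x := by
      intro x hx
      induction hx using AddSubmonoid.closure_induction with
      | mem x hx =>
        rw [hg x hx]
        split_ifs with hxα
        · subst hxα
          exact ⟨⟨1, by simp⟩, hα1.ge⟩
        · refine ⟨⟨0, by simp⟩, ?_⟩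
          rcases hsimple x hx with h1 | h1 <;> rw [h1]
          exact zero_le_one
      | zero => exact ⟨⟨0, by simp⟩, by simp⟩
      | add x y _ _ hx hy =>
        obtain ⟨⟨n, hn⟩, hx⟩ := hx
        obtain ⟨⟨m, hm⟩, hy⟩ := hy
        refine ⟨⟨n + m, by rw [map_add, hn, hm]; push_cast; rfl⟩, ?_⟩
        rw [map_add, map_add]
        exact add_le_add hx hy
    have hg1 : ∀ β ∈ Ψ, μ β = 1 → g β = 0 ∨ g β = 1 := by
      intro β hβ h1
      obtain ⟨⟨n, hn⟩, hle⟩ := hgcl β (hcl β hβ h1)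
      rw [h1, hn] at hle
      rw [hn]
      have : n ≤ 1 := by exact_mod_cast hle
      interval_cases n <;> simp
    have hg0 : ∀ β ∈ Ψ, μ β = 0 → g β = 0 := by
      have key : ∀ β ∈ Ψ, 0 < f β → μ β = 0 → g β = 0 := by
        intro β hβ hβ0 h1
        obtain ⟨⟨n, hn⟩, hle⟩ := hgcl β (h.mem_closure_simpleRoots f hβ hβ0)
        refine le_antisymm (hle.trans h1.le) ?_
        rw [hn]
        exact n.cast_nonneg
      intro β hβ h1
      rcases lt_or_gt_of_ne (hf β hβ) with hlt | hgt
      · have := key (-β) (h.neg_mem hβ) (by simpa using hlt) (by simpa using h1)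
        simpa using this
      · exact key β hβ hgt h1
    let S : Set V := {β | β ∈ Ψ ∧ μ β = 1 ∧ g β = 1}
    have horth : ∀ γ ∈ Ψ, μ γ = 1 → g γ = 0 → ∀ u ∈ S, B γ u = 0 := by
      rintro γ hγ hγ1 hγ0 u ⟨hu, hu1, hu1'⟩
      rcases lt_trichotomy (B γ u) 0 with hlt | heq | hgt
      · have hmem := h.root_add_mem hγ hu hlt (fun e ↦ by
          rw [e, map_neg, hu1] at hγ1
          norm_num at hγ1)
        have h1 := hμ' _ hmem
        rw [map_add, hγ1, hu1] at h1
        norm_num at h1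
      · exact heq
      · have hmem := h.root_sub_mem hγ hu hgt (fun e ↦ by
          rw [e, hu1'] at hγ0
          exact one_ne_zero hγ0)
        have h1 := hg0 _ hmem (by rw [map_sub, hγ1, hu1, sub_self])
        rw [map_sub, hγ0, hu1'] at h1
        norm_num at h1
    have hS : ∀ γ ∈ Ψ, μ γ = 1 → ∀ u ∈ S, co γ u • γ ∈ Submodule.span ℚ S := by
      intro γ hγ hγ1 u hu
      rcases hg1 γ hγ hγ1 with h1 | h1
      · rw [(h.co_eq_zero_iff hγ u).2 (horth γ hγ hγ1 h1 u hu), zero_smul]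
        exact zero_mem _
      · exact Submodule.smul_mem _ _ (Submodule.subset_span ⟨hγ, hγ1, h1⟩)
    have hsub := h.subset_span hirr S (fun γ hγ u hu ↦ by
      rcases hμ' γ hγ with h1 | h1 | h1
      · have h2 := hS (-γ) (h.neg_mem hγ) (by rw [map_neg, h1, neg_neg]) u hu
        rw [smul_neg, Submodule.neg_mem_iff] at h2
        by_cases h3 : co (-γ) u = 0
        · rw [h.co_eq_zero_iff (h.neg_mem hγ), map_neg, LinearMap.neg_apply, neg_eq_zero,
            ← h.co_eq_zero_iff hγ] at h3
          rw [h3, zero_smul]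
          exact zero_mem _
        · exact Submodule.smul_mem _ _ ((Submodule.smul_mem_iff _ h3).1 h2)
      · have hmem : u - co γ u • γ ∈ S := by
          refine ⟨h.refl_mem γ hγ u hu.1, ?_, ?_⟩
          · rw [map_sub, map_smul, h1, smul_zero, sub_zero, hu.2.1]
          · rw [map_sub, map_smul, hg0 γ hγ h1, smul_zero, sub_zero, hu.2.2]
        have h2 := Submodule.sub_mem _ (Submodule.subset_span (R := ℚ) hu)
          (Submodule.subset_span (R := ℚ) hmem)
        rwa [sub_sub_cancel] at h2
      · exact hS γ hγ h1 u hu) hα.1 (show α ∈ S from ⟨hα.1, hα1, by simp [hg α hα]⟩)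
    have hker : Submodule.span ℚ S ≤ LinearMap.ker (B δ₀) := by
      rw [Submodule.span_le]
      intro u hu
      exact horth δ₀ hδ₀.1 hδ₁ (by simp [hg δ₀ hδ₀, hne]) u hu
    exact (h.norm_pos hδ₀.1).ne' (hker (hsub hδ₀.1))
  refine ⟨Δ, hbase, α, hα, fun δ hδ ↦ ?_, fun β₀ hβ₀ hβ₀' ↦ ?_⟩
  · split_ifs with hδα
    · rw [hδα, hα1]
    · exact huniq δ hδ hδα
  · obtain ⟨β₁, hβ₁, hβ₁', hlen⟩ := hpm β₀ hβ₀ hβ₀'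
    let S : Set V := {β | β ∈ Ψ ∧ μ β = 1 ∧ B β β = B β₀ β₀}
    have hfin : S.Finite := h.finite.subset fun _ hx ↦ hx.1
    obtain ⟨β, ⟨hβ, hβ1, hβl⟩, hmin⟩ := hfin.exists_minimalFor f S ⟨β₁, hβ₁, hβ₁', hlen⟩
    have hneg : ∀ γ ∈ Δ, γ ≠ α → B γ β ≤ 0 := by
      intro γ hγ hne
      by_contra hcon
      push Not at hcon
      have hpos := (h.co_pos_iff hγ.1 β).2 hcon
      have hmem : β - co γ β • γ ∈ S := by
        refine ⟨h.refl_mem γ hγ.1 β hβ, ?_, (h.norm_refl hγ.1 β).trans hβl⟩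
        rw [map_sub, map_smul, huniq γ hγ hne, smul_zero, sub_zero, hβ1]
      have hmul := mul_pos hpos hγ.2.1
      have hle : f (β - co γ β • γ) ≤ f β := by
        rw [map_sub, map_smul, smul_eq_mul]
        linarith
      have h1 := hmin hmem hle
      simp only [map_sub, map_smul, smul_eq_mul] at h1
      linarith
    have hbound : ∀ x ∈ AddSubmonoid.closure Δ, B x β ≤ μ x * B α β := by
      intro x hx
      induction hx using AddSubmonoid.closure_induction with
      | mem x hx =>
        by_cases hxα : x = α
        · rw [hxα, hα1, one_mul]
        · rw [huniq x hx hxα, zero_mul]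
          exact hneg x hx hxα
      | zero => simp
      | add x y _ _ hx hy =>
        simp only [map_add, LinearMap.add_apply]
        linarith
    have h1 := hbound β (hcl β hβ hβ1)
    rw [hβ1, one_mul] at h1
    have h2 : 0 ≤ B (β - α) (β - α) := by
      rcases eq_or_ne (β - α) 0 with h0 | h0
      · simp [h0]
      · exact (h.pos _ h0).le
    simp only [map_sub, LinearMap.sub_apply] at h2
    rw [h.symm β α] at h2
    rw [← hβl]
    linarith

/-- If `χ` takes, up to sign, a single nonzero value `a` on the coroots of the long roots and a
different single nonzero value `b` on the coroots of the short roots, then these values are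
inversely proportional to the squared lengths. -/
lemma mul_norm_eq_of_ne (h : IsEuclidean Ψ co B) {χ α β : V} {a b : ℚ} (hα : α ∈ Ψ) (hβ : β ∈ Ψ)
    (hlt : B β β < B α α) (hB : B α β ≠ 0) (hχ : co α χ ≠ 0) (hab : a ≠ b)
    (ha : ∀ γ ∈ Ψ, B γ γ = B α α → co γ χ = 0 ∨ |co γ χ| = a)
    (hb : ∀ γ ∈ Ψ, B γ γ = B β β → co γ χ = 0 ∨ |co γ χ| = b) :
    b * B β β = a * B α α := by
  wlog hpos : 0 < B α β generalizing β
  · have := this (β := -β) (h.neg_mem hβ) (by simpa using hlt) (by simpa using hB)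
      (by simpa using hb) (by
        rw [map_neg]
        linarith [lt_of_le_of_ne (not_lt.1 hpos) hB])
    simpa using this
  have hNα := h.norm_pos hα
  have hNβ := h.norm_pos hβ
  have hne : α ≠ β := fun e ↦ hlt.ne (by rw [e])
  obtain ⟨hq, hp⟩ := (h.eq_or_pairing hα hβ hpos hlt.le).resolve_left hne
  have e1 := h.co_mul α hα β
  have e2 := h.co_mul β hβ α
  rw [h.symm β α] at e2
  set p := co β α
  have hN : B α α = p * B β β := by
    rw [hq] at e1
    linarith
  have hm1 := h.refl_mem α hα β hβ
  have hn1 := h.norm_refl hα β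
  have hm2 := h.refl_mem β hβ α hα
  have hn2 := h.norm_refl hβ α
  have f1 := h.co_mul _ hm1 χ
  have f2 := h.co_mul _ hm2 χ
  have f3 := h.co_mul α hα χ
  have f4 := h.co_mul β hβ χ
  have hv1 := hb _ hm1 hn1
  have hv2 := ha _ hm2 hn2
  rw [hn1] at f1
  rw [hn2] at f2
  rw [hq, one_smul] at f1 hv1
  simp only [map_sub, map_smul, LinearMap.sub_apply, LinearMap.smul_apply, smul_eq_mul] at f1 f2
  have g1 : co (β - α) χ = co β χ - p * co α χ := by
    apply mul_right_cancel₀ hNβ.ne'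
    rw [hN] at f3
    linear_combination f1 - f4 + f3
  have g2 : co (α - p • β) χ = co α χ - co β χ := by
    apply mul_right_cancel₀ hNα.ne'
    rw [hN] at f2 f3 ⊢
    linear_combination f2 - f3 + p * f4
  rw [g1] at hv1
  rw [g2] at hv2
  have hv3 := (ha α hα rfl).resolve_left hχ
  have hv4 := hb β hβ rfl
  have hfin : b = p * a := by
    rcases hp with hp | hp | hp
    · rw [hp, one_mul] at hN
      exact absurd hN hlt.ne'
    all_goals
      rw [hp] at hv1 ⊢
      generalize co α χ = x at *
      generalize co β χ = y at *
      clear f1 f2 f3 f4 g1 g2 hm1 hm2 hn1 hn2 ha hb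
      grind
  rw [hfin, hN]
  ring

lemma mono (h : IsEuclidean Ψ co B) {Ψ' : Set V} (hsub : Ψ' ⊆ Ψ)
    (hrefl : ∀ α ∈ Ψ', ∀ β ∈ Ψ', β - co α β • α ∈ Ψ') : IsEuclidean Ψ' co B where
  finite := h.finite.subset hsub
  symm := h.symm
  pos := h.pos
  ne_zero := fun α hα ↦ h.ne_zero α (hsub hα)
  co_mul := fun α hα ↦ h.co_mul α (hsub hα)
  pair_int := fun α hα β hβ ↦ h.pair_int α (hsub hα) β (hsub hβ)
  refl_mem := hrefl
  reduced := fun α hα c hc ↦ h.reduced α (hsub hα) c (hsub hc)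

/-- For non-orthogonal roots, the quotient of the larger norm by the smaller one is `1`, `2`
or `3`. -/
lemma norm_cases (h : IsEuclidean Ψ co B) {α β : V} (hα : α ∈ Ψ) (hβ : β ∈ Ψ) (hB : B α β ≠ 0)
    (hle : B β β ≤ B α α) : B α α = B β β ∨ B α α = 2 * B β β ∨ B α α = 3 * B β β := by
  wlog hpos : 0 < B α β generalizing β
  · have := this (β := -β) (h.neg_mem hβ) (by simpa using hB) (by simpa using hle) (by
        rw [map_neg]
        linarith [lt_of_le_of_ne (not_lt.1 hpos) hB])
    simpa using this
  rcases h.eq_or_pairing hα hβ hpos hle with rfl | ⟨hq, hp⟩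
  · exact Or.inl rfl
  · have e1 := h.co_mul α hα β
    have e2 := h.co_mul β hβ α
    rw [h.symm β α, ← e1, hq, one_mul] at e2
    rcases hp with hp | hp | hp <;> rw [hp] at e2
    · exact Or.inl (by linarith)
    · exact Or.inr (Or.inl (by linarith))
    · exact Or.inr (Or.inr (by linarith))

lemma reflection_mem_weylGroup (h : IsEuclidean Ψ co B) {α : V} (hα : α ∈ Ψ) :
    Module.reflection (h.co_self hα) ∈ weylGroup Ψ co :=
  Subgroup.subset_closure ⟨α, hα, fun _ ↦ Module.reflection_apply _ _⟩

/-- Non-orthogonal roots of the same length are conjugate under the Weyl group. -/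
lemma exists_weylGroup_map_eq (h : IsEuclidean Ψ co B) {α β : V} (hα : α ∈ Ψ) (hβ : β ∈ Ψ)
    (hB : B α β ≠ 0) (hN : B α α = B β β) : ∃ w ∈ weylGroup Ψ co, w α = β := by
  wlog hpos : 0 < B α β generalizing β
  · obtain ⟨w, hw, he⟩ := this (β := -β) (h.neg_mem hβ) (by simpa using hB) (by simpa using hN) (by
      rw [map_neg]
      linarith [lt_of_le_of_ne (not_lt.1 hpos) hB])
    refine ⟨Module.reflection (h.co_self hβ) * w, mul_mem (h.reflection_mem_weylGroup hβ) hw, ?_⟩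
    rw [LinearEquiv.mul_apply, he, map_neg, Module.reflection_apply_self, neg_neg]
  rcases h.eq_or_pairing hα hβ hpos hN.ge with rfl | ⟨hq, -⟩
  · exact ⟨1, one_mem _, rfl⟩
  · have hp : co β α = 1 := by
      have e1 := h.co_mul α hα β
      have e2 := h.co_mul β hβ α
      rw [h.symm β α, ← e1, hq, hN] at e2
      exact mul_right_cancel₀ (h.norm_pos hβ).ne' e2
    refine ⟨Module.reflection (h.co_self hβ) *
      (Module.reflection (h.co_self hα) * Module.reflection (h.co_self hβ)),
      mul_mem (h.reflection_mem_weylGroup hβ) (mul_mem (h.reflection_mem_weylGroup hα)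
        (h.reflection_mem_weylGroup hβ)), ?_⟩
    simp only [LinearEquiv.mul_apply, Module.reflection_apply, map_sub, map_smul, hp, hq,
      h.co_self hα, h.co_self hβ]
    module

/-- A cominuscule element takes on the coroot of a root `β` a value which is, up to sign, zero or
the ratio of the largest squared length to the squared length of `β`. -/
lemma co_mul_norm_of_isCominuscule (h : IsEuclidean Ψ co B) (hirr : IsIrreducible Ψ co)
    {ξ θ β : V} (hξ : IsCominuscule Ψ co ξ) (hwt : ξ ∈ weightLattice Ψ co) (hθ : θ ∈ Ψ)
    (hmax : ∀ γ ∈ Ψ, B γ γ ≤ B θ θ) (hβ : β ∈ Ψ) :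
    co β ξ = 0 ∨ |co β ξ| * B β β = B θ θ := by
  obtain ⟨-, Δ, hΔ, α, hα, hfund, hmin⟩ := hξ
  have hαΨ := hΔ.subset hα
  have hNα := h.norm_pos hαΨ
  have hαξ : co α ξ = 1 := by simpa using hfund α hα
  have hmin' : ∀ γ ∈ Ψ, co γ ξ = 0 ∨ |co γ ξ| * B γ γ = B α α := by
    have key : IsMinusculeCowt Ψ ((2 / B α α) • B ξ) := by
      apply hmin
      intro γ hγ
      have h1 := h.co_mul γ (hΔ.subset hγ) ξ
      rw [hfund γ hγ] at h1
      rw [LinearMap.smul_apply, smul_eq_mul, h.symm ξ γ, div_mul_eq_mul_div, ← h1]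
      split_ifs with hγα
      · rw [hγα, one_mul, div_self hNα.ne']
      · simp
    intro γ hγ
    have h1 := key γ hγ
    have h2 := h.co_mul γ hγ ξ
    have hNγ := h.norm_pos hγ
    rw [LinearMap.smul_apply, smul_eq_mul, h.symm ξ γ, div_mul_eq_mul_div, ← h2] at h1
    rw [← abs_of_pos hNγ, ← abs_mul]
    rcases h1 with h1 | h1 | h1
    · right
      rw [div_eq_iff hNα.ne'] at h1
      rw [h1, neg_one_mul, abs_neg, abs_of_pos hNα]
    · left
      rw [div_eq_zero_iff, or_iff_left hNα.ne', mul_eq_zero, or_iff_left hNγ.ne'] at h1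
      exact h1
    · right
      rw [Set.mem_singleton_iff, div_eq_iff hNα.ne'] at h1
      rw [h1, one_mul, abs_of_pos hNα]
  obtain ⟨γ, hγ, hγθ, hγξ⟩ := h.exists_norm_eq_ne_zero hirr hθ hαΨ (x := ξ)
    (by rw [ne_eq, ← h.co_eq_zero_iff hαΨ, hαξ]; exact one_ne_zero)
  have hγξ' : co γ ξ ≠ 0 := by rwa [ne_eq, h.co_eq_zero_iff hγ]
  have h1 : 1 ≤ |co γ ξ| := by
    obtain ⟨n, hn⟩ := hwt γ hγ
    rw [hn] at hγξ' ⊢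
    exact_mod_cast Int.one_le_abs (by exact_mod_cast hγξ')
  have h2 := (hmin' γ hγ).resolve_left hγξ'
  have h3 := hmax α hαΨ
  have h4 := h.norm_pos hγ
  have hαθ : B α α = B θ θ := by nlinarith
  exact hαθ ▸ hmin' β hβ

end IsEuclidean

/-- A linear automorphism preserving the roots and compatible with the coroots. -/
def PreservesRoots (Φ : Set V) (co : V → Module.Dual ℚ V) (g : V ≃ₗ[ℚ] V) : Prop :=
  ∀ α ∈ Φ, g α ∈ Φ ∧ co (g α) = coact g (co α)

lemma preservesRoots_of_mem_sup {Φ : Set V} {co : V → Module.Dual ℚ V}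
    (hRS : IsRootSystem Φ co) {Γ : Subgroup (V ≃ₗ[ℚ] V)}
    (hΓroot : ∀ g ∈ Γ, ∀ α ∈ Φ, g α ∈ Φ)
    (hΓco : ∀ g ∈ Γ, ∀ α ∈ Φ, co (g α) = coact g (co α)) :
    ∀ g ∈ weylGroup Φ co ⊔ Γ, PreservesRoots Φ co g := by
  suffices ∀ g ∈ weylGroup Φ co ⊔ Γ, PreservesRoots Φ co g ∧ PreservesRoots Φ co g⁻¹ from
    fun g hg ↦ (this g hg).1
  intro g hg
  rw [Subgroup.sup_eq_closure] at hg
  induction hg using Subgroup.closure_induction with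
  | mem g hg =>
    rcases hg with hg | hg
    · exact ⟨fun α hα ↦ ⟨hRS.weyl_root g hg α hα, hRS.weyl_coroot g hg α hα⟩,
        fun α hα ↦ ⟨hRS.weyl_root _ (inv_mem hg) α hα, hRS.weyl_coroot _ (inv_mem hg) α hα⟩⟩
    · exact ⟨fun α hα ↦ ⟨hΓroot g hg α hα, hΓco g hg α hα⟩,
        fun α hα ↦ ⟨hΓroot _ (inv_mem hg) α hα, hΓco _ (inv_mem hg) α hα⟩⟩
  | one => exact ⟨fun α hα ↦ ⟨hα, rfl⟩, fun α hα ↦ ⟨hα, rfl⟩⟩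
  | mul x y _ _ hx hy =>
    have key : ∀ x y : V ≃ₗ[ℚ] V, PreservesRoots Φ co x → PreservesRoots Φ co y →
        PreservesRoots Φ co (x * y) := by
      intro x y hx hy α hα
      obtain ⟨h1, h2⟩ := hy α hα
      obtain ⟨h3, h4⟩ := hx _ h1
      refine ⟨h3, ?_⟩
      rw [LinearEquiv.mul_apply, h4, h2]
      rfl
    rw [mul_inv_rev]
    exact ⟨key x y hx.1 hy.1, key _ _ hy.2 hx.2⟩
  | inv x _ hx => exact ⟨hx.2, by rw [inv_inv]; exact hx.1⟩

/-- The canonical bilinear form `(x, y) ↦ ∑ β, ⟨x, β∨⟩ ⟨y, β∨⟩`. -/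
noncomputable def rootForm {Φ : Set V} (hΦ : Φ.Finite) (co : V → Module.Dual ℚ V) :
    LinearMap.BilinForm ℚ V :=
  ∑ β ∈ hΦ.toFinset, (LinearMap.mul ℚ ℚ).compl₁₂ (co β) (co β)

lemma rootForm_apply {Φ : Set V} (hΦ : Φ.Finite) (co : V → Module.Dual ℚ V) (x y : V) :
    rootForm hΦ co x y = ∑ β ∈ hΦ.toFinset, co β x * co β y := by
  simp [rootForm, LinearMap.sum_apply]

lemma rootForm_map_map {Φ : Set V} (hΦ : Φ.Finite) {co : V → Module.Dual ℚ V} {g : V ≃ₗ[ℚ] V}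
    (hg : PreservesRoots Φ co g) (hg' : PreservesRoots Φ co g⁻¹) (x y : V) :
    rootForm hΦ co (g x) (g y) = rootForm hΦ co x y := by
  rw [rootForm_apply, rootForm_apply]
  refine Finset.sum_nbij' (fun β ↦ g⁻¹ β) (fun β ↦ g β) ?_ ?_ ?_ ?_ ?_
  · intro β hβ
    simpa using (hg' β (by simpa using hβ)).1
  · intro β hβ
    simpa using (hg β (by simpa using hβ)).1
  · intro β _
    exact g.apply_symm_apply β
  · intro β _
    exact g.symm_apply_apply β
  · intro β hβ
    rw [(hg' β (by simpa using hβ)).2]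
    rfl

section

variable {Φ : Set V} {co : V → Module.Dual ℚ V}

lemma IsRootSystem.preservesRoots_reflection (hRS : IsRootSystem Φ co) {α : V} (hα : α ∈ Φ) :
    PreservesRoots Φ co (Module.reflection (hRS.pair_self α hα)) := by
  have hmem : Module.reflection (hRS.pair_self α hα) ∈ weylGroup Φ co :=
    Subgroup.subset_closure ⟨α, hα, fun _ ↦ Module.reflection_apply _ _⟩
  exact fun β hβ ↦ ⟨hRS.weyl_root _ hmem β hβ, hRS.weyl_coroot _ hmem β hβ⟩

lemma IsRootSystem.eq_zero_of_forall_co (hRS : IsRootSystem Φ co)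
    (hspan : Submodule.span ℚ Φ = ⊤) {x : V} (hx : ∀ β ∈ Φ, co β x = 0) : x = 0 := by
  have key : ∀ y ∈ Submodule.span ℚ Φ, ∃ f ∈ Submodule.span ℚ (co '' Φ),
      y = ∑ β ∈ hRS.finite.toFinset, f β • β := by
    intro y hy
    induction hy using Submodule.span_induction with
    | mem α hα =>
      set s := Module.reflection (hRS.pair_self α hα)
      set v := ∑ β ∈ hRS.finite.toFinset, co α β • β with hv
      have hs : ∀ z, s z = z - co α z • α := fun _ ↦ Module.reflection_apply _ _
      have hss : ∀ z, s (s z) = z := Module.involutive_reflection _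
      have hsv : s v = -v := by
        rw [hv, map_sum, ← Finset.sum_neg_distrib]
        refine Finset.sum_nbij' s s ?_ ?_ ?_ ?_ ?_
        · intro β hβ
          simpa using (hRS.preservesRoots_reflection hα β (by simpa using hβ)).1
        · intro β hβ
          simpa using (hRS.preservesRoots_reflection hα β (by simpa using hβ)).1
        · exact fun β _ ↦ hss β
        · exact fun β _ ↦ hss β
        · intro β _
          have h1 : co α (s β) = -co α β := by
            rw [hs, map_sub, map_smul, hRS.pair_self α hα, smul_eq_mul]
            ring
          rw [map_smul, h1, neg_smul, neg_neg]
      have hcv : 0 < co α v := by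
        rw [hv, map_sum]
        refine Finset.sum_pos' (fun β _ ↦ ?_) ⟨α, by simpa using hα, ?_⟩
        · rw [map_smul, smul_eq_mul]
          exact mul_self_nonneg _
        · rw [map_smul, smul_eq_mul, hRS.pair_self α hα]
          norm_num
      have h2 : co α v • α = (2 : ℚ) • v := by
        have h3 := hs v
        rw [hsv] at h3
        rw [two_smul, ← sub_neg_eq_add v v, h3, sub_sub_cancel]
      refine ⟨(2 / co α v) • co α,
        Submodule.smul_mem _ _ (Submodule.subset_span (Set.mem_image_of_mem _ hα)), ?_⟩
      simp only [LinearMap.smul_apply, smul_assoc]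
      rw [← Finset.smul_sum, ← hv, div_eq_inv_mul, mul_smul, ← h2, smul_smul,
        inv_mul_cancel₀ hcv.ne', one_smul]
    | zero => exact ⟨0, zero_mem _, by simp⟩
    | add y z _ _ hy hz =>
      obtain ⟨f, hf, rfl⟩ := hy
      obtain ⟨g, hg, rfl⟩ := hz
      exact ⟨f + g, add_mem hf hg, by simp [add_smul, Finset.sum_add_distrib]⟩
    | smul c y _ hy =>
      obtain ⟨f, hf, rfl⟩ := hy
      exact ⟨c • f, Submodule.smul_mem _ _ hf, by simp [Finset.smul_sum, smul_smul]⟩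
  obtain ⟨f, hf, hxf⟩ := key x (hspan ▸ Submodule.mem_top)
  have hker : Submodule.span ℚ (co '' Φ) ≤ LinearMap.ker (Module.Dual.eval ℚ V x) := by
    rw [Submodule.span_le]
    rintro _ ⟨β, hβ, rfl⟩
    exact hx β hβ
  have hfx : f x = 0 := hker hf
  rw [hxf, map_sum, Finset.sum_eq_zero_iff_of_nonneg] at hfx
  · rw [hxf]
    refine Finset.sum_eq_zero fun β hβ ↦ ?_
    have := hfx β hβ
    rw [map_smul, smul_eq_mul, mul_self_eq_zero] at this
    rw [this, zero_smul]
  · intro β _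
    rw [map_smul, smul_eq_mul]
    exact mul_self_nonneg _

lemma IsRootSystem.isEuclidean (hRS : IsRootSystem Φ co) (hspan : Submodule.span ℚ Φ = ⊤) :
    IsEuclidean Φ co (rootForm hRS.finite co) where
  finite := hRS.finite
  symm := fun x y ↦ by
    rw [rootForm_apply, rootForm_apply]
    exact Finset.sum_congr rfl fun _ _ ↦ mul_comm _ _
  pos := by
    intro x hx
    rw [rootForm_apply]
    by_contra hcon
    have h0 := le_antisymm (not_lt.1 hcon) (Finset.sum_nonneg fun β _ ↦ mul_self_nonneg (co β x))
    rw [Finset.sum_eq_zero_iff_of_nonneg fun β _ ↦ mul_self_nonneg (co β x)] at h0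
    exact hx (hRS.eq_zero_of_forall_co hspan fun β hβ ↦
      mul_self_eq_zero.1 (h0 β (by simpa using hβ)))
  ne_zero := hRS.ne_zero
  co_mul := by
    intro α hα x
    have hinv : (Module.reflection (hRS.pair_self α hα))⁻¹
        = Module.reflection (hRS.pair_self α hα) := Module.reflection_symm _
    have h1 := rootForm_map_map hRS.finite (hRS.preservesRoots_reflection hα)
      (hinv ▸ hRS.preservesRoots_reflection hα) α x
    rw [Module.reflection_apply_self, Module.reflection_apply] at h1
    simp only [map_sub, map_smul, map_neg, LinearMap.neg_apply, smul_eq_mul] at h1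
    linarith
  pair_int := hRS.pair_int
  refl_mem := hRS.refl_mem
  reduced := hRS.reduced

end

/-- For a group of automorphisms transitive on roots of each length, quasi-constancy compares the
values on coroots of roots of equal length. -/
lemma isQuasiConstantWrt_iff {Φ : Set V} {co : V → Module.Dual ℚ V} {G : Subgroup (V ≃ₗ[ℚ] V)}
    (N : V → ℚ) (hG : ∀ g ∈ G, PreservesRoots Φ co g) (hN : ∀ g ∈ G, ∀ x, N (g x) = N x)
    (htrans : ∀ α ∈ Φ, ∀ β ∈ Φ, N α = N β → ∃ g ∈ G, g α = β) (χ : V) :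
    IsQuasiConstantWrt Φ co G χ ↔ ∀ α ∈ Φ, ∀ β ∈ Φ, N α = N β →
      co α χ = 0 ∨ co β χ = 0 ∨ |co β χ| = |co α χ| := by
  have hdiv : ∀ a b : ℚ, a ≠ 0 → (b / a ∈ ({-1, 0, 1} : Set ℚ) ↔ b = 0 ∨ |b| = |a|) := by
    intro a b ha
    rw [abs_eq_abs]
    simp only [Set.mem_insert_iff, Set.mem_singleton_iff, div_eq_iff ha, zero_mul, one_mul,
      neg_one_mul]
    tauto
  constructor
  · intro h α hα β hβ hαβ
    by_cases h0 : co α χ = 0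
    · exact Or.inl h0
    · obtain ⟨g, hg, rfl⟩ := htrans α hα β hβ hαβ
      rw [(hG g hg α hα).2]
      exact Or.inr ((hdiv _ _ h0).1 (h α hα h0 g hg))
  · intro h α hα h0 g hg
    rw [hdiv _ _ h0, ← (hG g hg α hα).2]
    exact (h α hα (g α) (hG g hg α hα).1 (hN g hg α).symm).resolve_left h0

end QC

/-- part 2 of Theorem 1.5 of the paper, character case. Suppose `Φ`
spans `V`, decomposes into irreducible components `Φ₁, …, Φ_d`, and `Γ` acts on the root
datum permuting the components transitively. Then `χ` in the weight lattice is
quasi-constant with respect to `W ⋊ Γ` iff there are an integer `m ≥ 1` and elements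
`ξ i` of the weight lattice of `Φᵢ` with `χᵢ = m • ξ i` for all `i`, every `ξ i` zero,
minuscule or cominuscule, and the nonzero `ξ i` all minuscule or all cominuscule. -/
theorem statement9 {V : Type*} [AddCommGroup V] [Module ℚ V] [FiniteDimensional ℚ V]
    (Φ : Set V) (co : V → Module.Dual ℚ V) (hRS : QC.IsRootSystem Φ co)
    (hspan : Submodule.span ℚ Φ = ⊤)
    (d : ℕ) (Φc : Fin d → Set V)
    (hunion : Φ = ⋃ i, Φc i)
    (hdisj : ∀ i j, i ≠ j → Disjoint (Φc i) (Φc j))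
    (hne : ∀ i, (Φc i).Nonempty)
    (hirr : ∀ i, QC.IsIrreducible (Φc i) co)
    (horth : ∀ i j, i ≠ j → ∀ α ∈ Φc i, ∀ β ∈ Φc j, co α β = 0)
    (π : Fin d → (V →ₗ[ℚ] V))
    (hπsum : ∀ x : V, ∑ i, π i x = x)
    (hπroot : ∀ i, ∀ α ∈ Φc i, π i α = α)
    (hπroot' : ∀ i j, i ≠ j → ∀ α ∈ Φc i, π j α = 0)
    (hπco : ∀ i, ∀ α ∈ Φc i, ∀ x : V, co α (π i x) = co α x)
    (Γ : Subgroup (V ≃ₗ[ℚ] V))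
    (hΓroot : ∀ g ∈ Γ, ∀ α ∈ Φ, g α ∈ Φ)
    (hΓco : ∀ g ∈ Γ, ∀ α ∈ Φ, co (g α) = QC.coact g (co α))
    (htrans : ∀ i j, ∃ g ∈ Γ, ∀ α ∈ Φc i, g α ∈ Φc j)
    (χ : V) (hχ : χ ∈ QC.weightLattice Φ co) :
    QC.IsQuasiConstantWrt Φ co (QC.weylGroup Φ co ⊔ Γ) χ ↔
      ∃ m : ℤ, 1 ≤ m ∧ ∃ ξ : Fin d → V,
        (∀ i, π i (ξ i) = ξ i) ∧
        (∀ i, ξ i ∈ QC.weightLattice (Φc i) co) ∧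
        (∀ i, π i χ = (m : ℚ) • ξ i) ∧
        (∀ i, ξ i = 0 ∨ QC.IsMinuscule (Φc i) co (ξ i) ∨
            QC.IsCominuscule (Φc i) co (ξ i)) ∧
        ((∀ i, ξ i ≠ 0 → QC.IsMinuscule (Φc i) co (ξ i)) ∨
          (∀ i, ξ i ≠ 0 → QC.IsCominuscule (Φc i) co (ξ i))) := by
  have hE := hRS.isEuclidean hspan
  set B := QC.rootForm hRS.finite co
  have hG := QC.preservesRoots_of_mem_sup hRS hΓroot hΓco
  have hGB : ∀ g ∈ QC.weylGroup Φ co ⊔ Γ, ∀ x y, B (g x) (g y) = B x y := fun g hg x y ↦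
    QC.rootForm_map_map hRS.finite (hG g hg) (hG _ (inv_mem hg)) x y
  have hsub : ∀ i, Φc i ⊆ Φ := fun i ↦ hunion ▸ Set.subset_iUnion Φc i
  have hmem : ∀ α ∈ Φ, ∃ i, α ∈ Φc i := fun α hα ↦ by simpa [hunion] using hα
  have hEc : ∀ i, QC.IsEuclidean (Φc i) co B := by
    refine fun i ↦ hE.mono (hsub i) fun α hα β hβ ↦ ?_
    have h1 := hE.refl_mem α (hsub i hα) β (hsub i hβ)
    obtain ⟨j, hj⟩ := hmem _ h1
    by_cases hij : i = j
    · exact hij ▸ hj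
    · have h2 := hπroot j _ hj
      rw [map_sub, map_smul, hπroot' i j hij α hα, hπroot' i j hij β hβ, smul_zero,
        sub_zero] at h2
      exact absurd h2.symm (hE.ne_zero _ h1)
  have hπspan : ∀ i x, π i x ∈ Submodule.span ℚ (Φc i) := by
    intro i x
    have hx : x ∈ Submodule.span ℚ Φ := hspan ▸ Submodule.mem_top
    induction hx using Submodule.span_induction with
    | mem α hα =>
      obtain ⟨j, hj⟩ := hmem α hα
      by_cases hij : j = i
      · subst hij
        rw [hπroot j α hj]
        exact Submodule.subset_span hj
      · rw [hπroot' j i hij α hj]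
        exact zero_mem _
    | zero => rw [map_zero]; exact zero_mem _
    | add x y _ _ hx hy => rw [map_add]; exact add_mem hx hy
    | smul c x _ hx => rw [map_smul]; exact Submodule.smul_mem _ _ hx
  have hπid : ∀ i, ∀ x ∈ Submodule.span ℚ (Φc i), π i x = x := by
    intro i x hx
    have hle : Submodule.span ℚ (Φc i) ≤ LinearMap.eqLocus (π i) LinearMap.id :=
      Submodule.span_le.2 (hπroot i)
    exact hle hx
  have hconn : ∀ α ∈ Φ, ∀ β ∈ Φ, ∃ g ∈ QC.weylGroup Φ co ⊔ Γ, B (g α) β ≠ 0 := by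
    intro α hα β hβ
    obtain ⟨i, hi⟩ := hmem α hα
    obtain ⟨j, hj⟩ := hmem β hβ
    obtain ⟨g, hg, hgij⟩ := htrans i j
    have hgG : g ∈ QC.weylGroup Φ co ⊔ Γ := Subgroup.mem_sup_right hg
    obtain ⟨γ, ⟨g', hg', rfl⟩, hγ⟩ := (hEc j).exists_mem_ne_zero (hirr j)
      (S := {γ | ∃ g ∈ QC.weylGroup Φ co ⊔ Γ, g α = γ}) (by
        rintro γ hγ _ ⟨g', hg', rfl⟩
        exact ⟨Module.reflection (hE.co_self (hsub j hγ)) * g', mul_mem (Subgroup.mem_sup_left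
          (hE.reflection_mem_weylGroup (hsub j hγ))) hg', by
            rw [LinearEquiv.mul_apply, Module.reflection_apply]⟩)
      (hgij α hi) ⟨g, hgG, rfl⟩ hj (hE.norm_pos hβ).ne'
    exact ⟨g', hg', hγ⟩
  have hsame : ∀ α ∈ Φ, ∀ β ∈ Φ, B α α = B β β → ∃ g ∈ QC.weylGroup Φ co ⊔ Γ, g α = β := by
    intro α hα β hβ hN
    obtain ⟨g, hg, hgB⟩ := hconn α hα β hβ
    obtain ⟨w, hw, he⟩ := hE.exists_weylGroup_map_eq (hG g hg α hα).1 hβ hgB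
      ((hGB g hg α α).trans hN)
    exact ⟨w * g, mul_mem (Subgroup.mem_sup_left hw) hg, he⟩
  rw [QC.isQuasiConstantWrt_iff (fun x ↦ B x x) hG (fun g hg x ↦ hGB g hg x x) hsame χ]
  have hlong : ∀ i, ∃ θ ∈ Φc i, ∀ γ ∈ Φ, B γ γ ≤ B θ θ := by
    intro i
    obtain ⟨α, hα⟩ := hne i
    obtain ⟨θ, hθ, hmax⟩ := Set.exists_max_image Φ (fun x ↦ B x x) hE.finite ⟨α, hsub i hα⟩
    obtain ⟨j, hj⟩ := hmem θ hθ
    obtain ⟨g, hg, hgj⟩ := htrans j i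
    exact ⟨g θ, hgj θ hj, fun γ hγ ↦ by
      rw [hGB g (Subgroup.mem_sup_right hg)]
      exact hmax γ hγ⟩
  constructor
  · intro hqc
    by_cases hχ0 : χ = 0
    · refine ⟨1, le_rfl, fun _ ↦ 0, fun i ↦ map_zero _, fun i β _ ↦ ⟨0, by simp⟩, fun i ↦ ?_,
        fun i ↦ Or.inl rfl, Or.inl fun i h ↦ absurd rfl h⟩
      rw [hχ0, map_zero, smul_zero]
    obtain ⟨β₀, hβ₀, hβχ⟩ : ∃ β ∈ Φ, co β χ ≠ 0 := by
      by_contra hcon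
      push Not at hcon
      exact hχ0 (hRS.eq_zero_of_forall_co hspan hcon)
    obtain ⟨i₀, hi₀⟩ := hmem β₀ hβ₀
    obtain ⟨θ, hθ, hmax⟩ := hlong i₀
    obtain ⟨α, hα', hαθ, hαχ⟩ := (hEc i₀).exists_norm_eq_ne_zero (hirr i₀) hθ hi₀
      (by rwa [ne_eq, ← hE.co_eq_zero_iff hβ₀])
    have hα := hsub i₀ hα'
    rw [ne_eq, ← hE.co_eq_zero_iff hα] at hαχ
    rw [← hαθ] at hmax
    obtain ⟨n, hn⟩ := hχ α hα
    have hn0 : n ≠ 0 := by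
      rintro rfl
      exact hαχ (by simpa using hn)
    have hm1 : 1 ≤ |n| := Int.one_le_abs hn0
    have ham : |co α χ| = ((|n| : ℤ) : ℚ) := by rw [hn]; push_cast; rfl
    set a := |co α χ| with ha
    have ha0 : 0 < a := abs_pos.2 hαχ
    have hξco : ∀ i, ∀ β ∈ Φc i, co β (a⁻¹ • π i χ) = a⁻¹ * co β χ := fun i β hβ ↦ by
      rw [map_smul, hπco i β hβ, smul_eq_mul]
    have hvalα : ∀ γ ∈ Φ, B γ γ = B α α → co γ χ = 0 ∨ |co γ χ| = a := fun γ hγ hN ↦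
      (hqc α hα γ hγ hN.symm).resolve_left hαχ
    suffices hmain : (∀ i, ∀ β ∈ Φc i, ∃ n : ℤ, co β (a⁻¹ • π i χ) = n) ∧
        ((∀ i, a⁻¹ • π i χ ≠ 0 → QC.IsMinuscule (Φc i) co (a⁻¹ • π i χ)) ∨
          (∀ i, a⁻¹ • π i χ ≠ 0 → QC.IsCominuscule (Φc i) co (a⁻¹ • π i χ))) by
      refine ⟨|n|, hm1, fun i ↦ a⁻¹ • π i χ, fun i ↦ hπid i _ (Submodule.smul_mem _ _ (hπspan i χ)),
        hmain.1, fun i ↦ ?_, fun i ↦ ?_, hmain.2⟩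
      · rw [← ham, smul_smul, mul_inv_cancel₀ ha0.ne', one_smul]
      · by_cases h0 : a⁻¹ • π i χ = 0
        · exact Or.inl h0
        · rcases hmain.2 with h | h
          · exact Or.inr (Or.inl (h i h0))
          · exact Or.inr (Or.inr (h i h0))
    have hval : ∀ x : ℚ, x = 0 ∨ |x| = a → a⁻¹ * x = -1 ∨ a⁻¹ * x = 0 ∨ a⁻¹ * x = 1 := by
      intro x hx
      rcases hx with rfl | hx
      · simp
      · rcases (abs_eq ha0.le).1 hx with rfl | rfl
        · exact Or.inr (Or.inr (inv_mul_cancel₀ ha0.ne'))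
        · left
          rw [mul_neg, inv_mul_cancel₀ ha0.ne']
    by_cases hall : ∀ β ∈ Φ, co β χ = 0 ∨ |co β χ| = a
    · have hmin : ∀ i, QC.IsMinuscule (Φc i) co (a⁻¹ • π i χ) := fun i β hβ ↦ by
        rw [hξco i β hβ]
        exact hval _ (hall β (hsub i hβ))
      refine ⟨fun i β hβ ↦ ?_, Or.inl fun i _ ↦ hmin i⟩
      rcases hmin i β hβ with h | h | h
      · exact ⟨-1, by rw [h]; norm_num⟩
      · exact ⟨0, by rw [h]; norm_num⟩
      · exact ⟨1, by rw [h]; norm_num⟩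
    push Not at hall
    obtain ⟨β₁, hβ₁, hβ₁0, hβ₁a⟩ := hall
    have hlt : B β₁ β₁ < B α α := lt_of_le_of_ne (hmax β₁ hβ₁) fun he ↦
      (hvalα β₁ hβ₁ he).elim hβ₁0 hβ₁a
    have hvalβ : ∀ γ ∈ Φ, B γ γ = B β₁ β₁ → co γ χ = 0 ∨ |co γ χ| = |co β₁ χ| := fun γ hγ hN ↦
      (hqc β₁ hβ₁ γ hγ hN.symm).resolve_left hβ₁0
    have hprod : |co β₁ χ| * B β₁ β₁ = a * B α α := by
      obtain ⟨g, hg, hgB⟩ := hconn β₁ hβ₁ α hα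
      have hgN := hGB g hg β₁ β₁
      rw [hE.symm] at hgB
      have := hE.mul_norm_eq_of_ne hα (hG g hg β₁ hβ₁).1 (hgN ▸ hlt) hgB hαχ hβ₁a.symm hvalα
        (by rwa [hgN])
      rwa [hgN] at this
    have hratio : ∀ γ ∈ Φ, ∀ δ ∈ Φ, B γ γ ≤ B δ δ →
        B δ δ = B γ γ ∨ B δ δ = 2 * B γ γ ∨ B δ δ = 3 * B γ γ := by
      intro γ hγ δ hδ hle
      obtain ⟨g, hg, hgB⟩ := hconn δ hδ γ hγ
      have := hE.norm_cases (hG g hg δ hδ).1 hγ hgB (by rwa [hGB g hg])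
      rwa [hGB g hg] at this
    have htwo : ∀ γ ∈ Φ, B γ γ = B α α ∨ B γ γ = B β₁ β₁ := by
      intro γ hγ
      have h1 := hratio γ hγ α hα (hmax γ hγ)
      have h2 := hratio β₁ hβ₁ α hα hlt.le
      have h3 := hE.norm_pos hγ
      have h4 := hE.norm_pos hβ₁
      rcases le_total (B γ γ) (B β₁ β₁) with hle | hle
      · have h5 := hratio γ hγ β₁ hβ₁ hle
        grind
      · have h5 := hratio β₁ hβ₁ γ hγ hle
        grind
    have hNα := hE.norm_pos hα
    have hprop : ∀ γ ∈ Φ, co γ χ = 0 ∨ |co γ χ| * B γ γ = a * B α α := by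
      intro γ hγ
      rcases htwo γ hγ with h | h
      · rcases hvalα γ hγ h with h' | h'
        · exact Or.inl h'
        · exact Or.inr (by rw [h', h])
      · rcases hvalβ γ hγ h with h' | h'
        · exact Or.inl h'
        · exact Or.inr (by rw [h', h, hprod])
    refine ⟨fun i γ hγ ↦ ?_, Or.inr fun i hi ↦ ?_⟩
    · rw [hξco i γ hγ]
      rcases hprop γ (hsub i hγ) with h | h
      · exact ⟨0, by simp [h]⟩
      · have h1 := hE.norm_pos (hsub i hγ)
        obtain ⟨p, hp⟩ : ∃ p : ℤ, B α α = p * B γ γ := by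
          rcases hratio γ (hsub i hγ) α hα (hmax γ (hsub i hγ)) with h2 | h2 | h2
          · exact ⟨1, by simpa using h2⟩
          · exact ⟨2, by simpa using h2⟩
          · exact ⟨3, by simpa using h2⟩
        rw [hp, ← mul_assoc] at h
        have h3 := mul_right_cancel₀ h1.ne' h
        have hap : 0 ≤ a * (p : ℚ) := h3 ▸ abs_nonneg _
        rcases (abs_eq hap).1 h3 with h4 | h4
        · exact ⟨p, by rw [h4, inv_mul_cancel_left₀ ha0.ne']⟩
        · exact ⟨-p, by rw [h4, mul_neg, inv_mul_cancel_left₀ ha0.ne']; push_cast; rfl⟩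
    · set ξ := a⁻¹ • π i χ with hξ
      have hξspan : ξ ∈ Submodule.span ℚ (Φc i) := Submodule.smul_mem _ _ (hπspan i χ)
      obtain ⟨γ₀, hγ₀, hγ₀'⟩ : ∃ γ ∈ Φc i, co γ ξ ≠ 0 := by
        by_contra hcon
        push Not at hcon
        refine hi (hRS.eq_zero_of_forall_co hspan fun γ hγ ↦ ?_)
        obtain ⟨j, hj⟩ := hmem γ hγ
        by_cases hij : j = i
        · exact hcon γ (hij ▸ hj)
        · rw [← hπid i ξ hξspan, ← hπco j γ hj]
          have hle : Submodule.span ℚ (Φc i) ≤ LinearMap.ker (π j) :=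
            Submodule.span_le.2 fun δ hδ ↦ hπroot' i j (Ne.symm hij) δ hδ
          rw [hπid i ξ hξspan, hle hξspan, map_zero]
      let μ : Module.Dual ℚ V := (2 / B α α) • B ξ
      have hμco : ∀ γ ∈ Φc i, μ γ = a⁻¹ * (co γ χ * B γ γ / B α α) := by
        intro γ hγ
        have h1 := hE.co_mul γ (hsub i hγ) ξ
        rw [hξ, hξco i γ hγ, ← hξ] at h1
        rw [LinearMap.smul_apply, smul_eq_mul, hE.symm ξ γ, div_mul_eq_mul_div, ← h1]
        ring
      have hμmin : QC.IsMinusculeCowt (Φc i) μ := by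
        intro γ hγ
        rw [hμco γ hγ]
        refine hval _ ?_
        have hNγ := hE.norm_pos (hsub i hγ)
        rcases hprop γ (hsub i hγ) with h | h
        · exact Or.inl (by simp [h])
        · right
          rw [abs_div, abs_mul, abs_of_pos hNγ, abs_of_pos hNα, h, mul_div_cancel_right₀ _ hNα.ne']
      have hμ0 : ∀ γ ∈ Φc i, co γ ξ ≠ 0 → μ γ ≠ 0 := by
        intro γ hγ h0
        rw [ne_eq, hE.co_eq_zero_iff (hsub i hγ), hE.symm] at h0
        exact mul_ne_zero (div_ne_zero two_ne_zero hNα.ne') h0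
      obtain ⟨Δ, hΔ, δ, hδ, hfund, hlen⟩ := (hEc i).exists_base_of_isMinusculeCowt (hirr i)
        hμmin hγ₀ (hμ0 γ₀ hγ₀ hγ₀')
      have hδi := hΔ.subset hδ
      have hδN : B δ δ = B α α := by
        obtain ⟨θ', hθ', hmax'⟩ := hlong i
        obtain ⟨ε, hε, hεN, hεξ⟩ := (hEc i).exists_norm_eq_ne_zero (hirr i) hθ' hγ₀
          (x := ξ) (by rwa [ne_eq, ← hE.co_eq_zero_iff (hsub i hγ₀)])
        have h1 := hlen ε hε (hμ0 ε hε (by rwa [ne_eq, hE.co_eq_zero_iff (hsub i hε)]))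
        have h2 := hmax' α hα
        have h3 := hmax δ (hsub i hδi)
        linarith
      refine ⟨hξspan, Δ, hΔ, δ, hδ, fun γ hγ ↦ ?_, fun f hf γ hγ ↦ ?_⟩
      · have h1 := hfund γ hγ
        have h2 := hE.co_mul γ (hsub i (hΔ.subset hγ)) ξ
        have hNγ := hE.norm_pos (hsub i (hΔ.subset hγ))
        rw [LinearMap.smul_apply, smul_eq_mul, hE.symm ξ γ, div_mul_eq_mul_div, ← h2] at h1
        by_cases hγδ : γ = δ
        · rw [if_pos hγδ] at h1 ⊢
          rwa [hγδ, hδN, mul_div_cancel_right₀ _ hNα.ne', ← hγδ] at h1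
        · rw [if_neg hγδ] at h1 ⊢
          simpa [hNγ.ne', hNα.ne'] using h1
      · have hle : Submodule.span ℚ Δ ≤ LinearMap.eqLocus f μ :=
          Submodule.span_le.2 fun ε hε ↦ (hf ε hε).trans (hfund ε hε).symm
        have h1 : f γ = μ γ := hle (hΔ.span_eq ▸ Submodule.subset_span hγ)
        rw [h1]
        exact hμmin γ hγ
  · rintro ⟨m, hm, ξ, -, hξwt, hξχ, -, hξ⟩
    have hm0 : (0 : ℚ) < m := by exact_mod_cast (by omega : 0 < m)
    have hco : ∀ i, ∀ β ∈ Φc i, co β χ = m * co β (ξ i) := fun i β hβ ↦ by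
      rw [← hπco i β hβ, hξχ, map_smul, smul_eq_mul]
    intro α hα β hβ hN
    obtain ⟨i, hi⟩ := hmem α hα
    obtain ⟨j, hj⟩ := hmem β hβ
    rw [hco i α hi, hco j β hj, mul_eq_zero, mul_eq_zero, or_iff_right hm0.ne',
      or_iff_right hm0.ne', abs_mul, abs_mul, mul_right_inj' (abs_pos.2 hm0.ne').ne']
    rcases hξ with hξ | hξ
    · have key : ∀ i, ∀ γ ∈ Φc i, co γ (ξ i) = 0 ∨ |co γ (ξ i)| = 1 := by
        intro i γ hγ
        by_cases h0 : ξ i = 0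
        · exact Or.inl (by rw [h0, map_zero])
        · rcases hξ i h0 γ hγ with h | h | h
          · exact Or.inr (by rw [h]; norm_num)
          · exact Or.inl h
          · exact Or.inr (by rw [h]; norm_num)
      rcases key i α hi with h | h
      · exact Or.inl h
      · rcases key j β hj with h' | h'
        · exact Or.inr (Or.inl h')
        · exact Or.inr (Or.inr (h'.trans h.symm))
    · obtain ⟨θ, hθ, hmax⟩ := hlong i
      have key : ∀ i, ∀ γ ∈ Φc i, co γ (ξ i) = 0 ∨ |co γ (ξ i)| * B γ γ = B θ θ := by
        intro k γ hγ
        by_cases h0 : ξ k = 0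
        · exact Or.inl (by rw [h0, map_zero])
        · obtain ⟨θ', hθ', hmax'⟩ := hlong k
          have heq : B θ' θ' = B θ θ :=
            le_antisymm (hmax θ' (hsub k hθ')) (hmax' θ (hsub i hθ))
          exact heq ▸ (hEc k).co_mul_norm_of_isCominuscule (hirr k) (hξ k h0) (hξwt k) hθ'
            (fun γ hγ ↦ hmax' γ (hsub k hγ)) hγ
      rcases key i α hi with h | h
      · exact Or.inl h
      · rcases key j β hj with h' | h'
        · exact Or.inr (Or.inl h')
        · refine Or.inr (Or.inr ?_)
          rw [← h, ← hN] at h'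
          exact mul_right_cancel₀ (hE.norm_pos hα).ne' h'
end
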